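/- arXiv:math/0605715 — 2 statements merged into one kernel-verified Lean document; each statement's English description precedes it below -/
import Mathlib

section
/- With the rays a_k·(1,1/ρ) and a_k·(ρ,1) oriented towards infinity, the analytic continuations of the Szegő function branches satisfy, for each k = 1,…,m: [D_i(W;z)]_+ = e^{−2πiβ_k}[D_i(W;z)]_− for z ∈ a_k·(1,1/ρ), and [D_e(W;z)]_+ = e^{−2πiβ_k}[D_e(W;z)]_− for z ∈ a_k·(ρ,1), where the subscripts + and − denote boundary values from the left and right of the oriented ray. Moreover W(z) = D_i(W;z)/D_e(W;z) holds on 𝕋 and provides the analytic continuation of W to the cut annulus 𝔸_ρ ∖ ⋃_k a_k·(ρ,1/ρ). -/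
open scoped Real
open Filter MeasureTheory Metric Set Polynomial

open Topology

theorem circleMap_add_ne {θ₀ θ : ℝ} (hθ : θ ∈ Icc 0 (2 * π)) (hne : θ ≠ π) :
    circleMap 0 1 (θ + (θ₀ - π)) ≠ circleMap 0 1 θ₀ := by
  intro h
  rw [circleMap_eq_circleMap_iff _ one_ne_zero] at h
  obtain ⟨n, hn⟩ := h
  have h2 : θ - π = n * (2 * π) := by
    have : ((θ - π : ℝ) : ℂ) * Complex.I = ((n * (2 * π) : ℝ) : ℂ) * Complex.I := by
      push_cast at hn ⊢
      linear_combination hn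
    exact_mod_cast mul_right_cancel₀ Complex.I_ne_zero this
  have hπ := Real.pi_pos
  have h3 : (n : ℝ) < 1 := by
    by_contra! h
    nlinarith [hθ.2]
  have h4 : (-1 : ℝ) < n := by
    by_contra! h
    nlinarith [hθ.1]
  have h5 : n = 0 := by
    have h3' : n < 1 := by exact_mod_cast h3
    have h4' : -1 < n := by exact_mod_cast h4
    omega
  apply hne
  rw [h5] at h2
  simp at h2
  linarith

/-- Radial limits of the Poisson integral at points of continuity. -/
theorem tendsto_circleAverage_poissonKernel {f : ℂ → ℝ} {z₀ : ℂ} (hf : CircleIntegrable f 0 1)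
    (hz₀ : ‖z₀‖ = 1) (hc : ContinuousWithinAt f (sphere 0 1) z₀) :
    Tendsto (fun r : ℝ => Real.circleAverage (poissonKernel 0 (r * z₀) • f) 0 1) (𝓝[<] 1)
      (𝓝 (f z₀)) := by
  obtain ⟨θ₀, hθ₀⟩ : ∃ θ₀ : ℝ, z₀ = circleMap 0 1 θ₀ :=
    ⟨z₀.arg, by
      have := Complex.norm_mul_exp_arg_mul_I z₀
      simpa [circleMap, hz₀] using this.symm⟩
  have hπ := Real.pi_pos
  set e : ℝ → ℂ := fun θ => circleMap 0 1 (θ + (θ₀ - π)) with he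
  have hec : Continuous e := by fun_prop
  have hen : ∀ θ, ‖e θ‖ = 1 := fun θ => by simp [he]
  have heπ : e π = z₀ := by simp [he, hθ₀]
  have hr : Ioo (0 : ℝ) 1 ∈ 𝓝[<] (1 : ℝ) := Ioo_mem_nhdsLT zero_lt_one
  have hball : ∀ r ∈ Ioo (0 : ℝ) 1, (r : ℂ) * z₀ ∈ ball (0 : ℂ) 1 := fun r hr => by
    simp [hz₀, abs_of_pos hr.1, hr.2]
  have hden : ∀ r ∈ Ioo (0 : ℝ) 1, ∀ θ, e θ - (r * z₀) ≠ 0 := fun r hr θ h => by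
    have := hball r hr
    rw [← sub_eq_zero.1 h] at this
    simp [hen] at this
  have hcont : ∀ r ∈ Ioo (0 : ℝ) 1, Continuous fun θ => poissonKernel 0 (r * z₀) (e θ) := by
    intro r hr
    simp only [poissonKernel_def, sub_zero]
    refine Continuous.div (by fun_prop) (by fun_prop) fun θ => ?_
    simpa using hden r hr θ
  have key := tendsto_setIntegral_peak_smul_of_integrableOn_of_tendsto
    (μ := volume) (s := Ioc (0 : ℝ) (2 * π)) (t := Ioc (0 : ℝ) (2 * π)) (x₀ := π) (a := f z₀)
    (φ := fun r θ => (2 * π)⁻¹ * poissonKernel 0 (r * z₀) (e θ)) (g := fun θ => f (e θ))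
    (l := 𝓝[<] (1 : ℝ)) measurableSet_Ioc measurableSet_Ioc Subset.rfl self_mem_nhdsWithin
    measure_Ioc_lt_top.ne ?_ ?_ ?_ ?_ ?_ ?_
  · refine key.congr fun r => ?_
    rw [Real.circleAverage_eq_integral_add (θ₀ - π), intervalIntegral.integral_of_le (by positivity),
      ← integral_smul]
    simp [he, smul_eq_mul, mul_assoc]
  · filter_upwards [hr] with r hr θ _
    simp only [poissonKernel_def, sub_zero, hen, norm_mul, hz₀, mul_one, Complex.norm_real,
      Real.norm_eq_abs, sq_abs]
    have : r ^ 2 ≤ 1 := by nlinarith [hr.1, hr.2]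
    have : 0 ≤ 1 ^ 2 - r ^ 2 := by linarith
    positivity
  · intro u hu hπu
    have hK : IsCompact (Icc 0 (2 * π) \ u) := isCompact_Icc.diff hu
    obtain ⟨δ, hδ, hδK⟩ : ∃ δ > 0, ∀ θ ∈ Icc 0 (2 * π) \ u, δ ≤ ‖e θ - z₀‖ := by
      rcases (Icc 0 (2 * π) \ u).eq_empty_or_nonempty with h | h
      · exact ⟨1, one_pos, by simp [h]⟩
      · obtain ⟨x, hx, hmin⟩ := hK.exists_isMinOn h
          (f := fun θ => ‖e θ - z₀‖) (by fun_prop)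
        refine ⟨_, ?_, hmin⟩
        rw [gt_iff_lt, norm_pos_iff, sub_ne_zero, hθ₀]
        exact circleMap_add_ne hx.1 fun h => hx.2 (h ▸ hπu)
    rw [Metric.tendstoUniformlyOn_iff]
    intro ε hε
    have h1 : Tendsto (fun r : ℝ => (2 * π)⁻¹ * ((1 - r ^ 2) / (δ / 2) ^ 2)) (𝓝[<] 1) (𝓝 0) := by
      have : Continuous (fun r : ℝ => (2 * π)⁻¹ * ((1 - r ^ 2) / (δ / 2) ^ 2)) := by fun_prop
      simpa using (this.tendsto 1).mono_left nhdsWithin_le_nhds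
    have h2 : ∀ᶠ r : ℝ in 𝓝[<] 1, 1 - δ / 2 < r :=
      nhdsWithin_le_nhds (lt_mem_nhds (by linarith))
    filter_upwards [hr, h2, h1.eventually_lt_const hε] with r hr h2 h1 θ hθ
    have hlow : δ / 2 ≤ ‖e θ - r * z₀‖ := by
      have h3 := hδK θ ⟨Ioc_subset_Icc_self hθ.1, hθ.2⟩
      have h4 : ‖(r : ℂ) * z₀ - z₀‖ = 1 - r := by
        rw [← sub_one_mul, norm_mul, hz₀, mul_one, ← Complex.ofReal_one, ← Complex.ofReal_sub,
          Complex.norm_real, Real.norm_eq_abs, abs_sub_comm, abs_of_pos (by linarith [hr.2])]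
      have h5 : ‖e θ - z₀‖ ≤ ‖e θ - r * z₀‖ + ‖(r : ℂ) * z₀ - z₀‖ := by
        simpa using norm_add_le (e θ - r * z₀) (r * z₀ - z₀)
      linarith
    have hr2 : 0 ≤ 1 - r ^ 2 := by nlinarith [hr.1, hr.2]
    simp only [Pi.zero_apply, dist_zero_left, poissonKernel_def, sub_zero, hen, norm_mul, hz₀,
      mul_one, Complex.norm_real, Real.norm_eq_abs, sq_abs, one_pow]
    rw [abs_of_nonneg (by positivity), abs_of_nonneg (by positivity)]
    refine lt_of_le_of_lt ?_ h1
    gcongr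
  · refine tendsto_const_nhds.congr' ?_
    filter_upwards [hr] with r hr
    have h1 := (diffContOnCl_const (c := (1 : ℂ))
      (s := ball (0 : ℂ) 1)).circleAverage_poissonKernel_smul (hball r hr)
    rw [Real.circleAverage_eq_integral_add (θ₀ - π)] at h1
    have h2 : (((2 * π)⁻¹ * ∫ θ in (0 : ℝ)..2 * π, poissonKernel 0 (r * z₀) (e θ) : ℝ) : ℂ) = 1 := by
      rw [Complex.ofReal_mul, ← intervalIntegral.integral_ofReal]
      simpa [he] using h1
    rw [← intervalIntegral.integral_of_le (by positivity), intervalIntegral.integral_const_mul]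
    exact_mod_cast h2.symm
  · filter_upwards [hr] with r hr
    exact ((hcont r hr).const_mul _).aestronglyMeasurable
  · rw [← intervalIntegrable_iff_integrableOn_Ioc_of_le (by positivity)]
    have hper : Function.Periodic (fun θ => f (circleMap 0 1 θ)) (2 * π) :=
      (periodic_circleMap 0 1).comp f
    have h1 : IntervalIntegrable (fun θ => f (circleMap 0 1 θ)) volume (θ₀ - π)
        (θ₀ - π + 2 * π) :=
      hper.intervalIntegrable (t := 0) (by positivity) (by simpa [CircleIntegrable] using hf) _ _
    have := h1.comp_add_right (θ₀ - π)
    simpa [he] using this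
  · have h1 : Tendsto e (𝓝[Ioc 0 (2 * π)] π) (𝓝[sphere 0 1] z₀) := by
      refine tendsto_nhdsWithin_iff.2 ⟨?_, Eventually.of_forall fun θ => by simp [hen]⟩
      simpa [heπ] using (hec.tendsto π).mono_left nhdsWithin_le_nhds
    exact hc.tendsto.comp h1

/-- The continuation `2 - v - v⁻¹` of `‖v - 1‖ ^ 2` from the unit circle to `ℂ \ {0}`. -/
noncomputable def sqDistOne (v : ℂ) : ℂ := 2 - v - v⁻¹

theorem sqDistOne_of_norm_eq_one {v : ℂ} (hv : ‖v‖ = 1) :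
    sqDistOne v = ((‖v - 1‖ ^ 2 : ℝ) : ℂ) := by
  have h : v * (starRingEnd ℂ) v = 1 := by
    rw [Complex.mul_conj, Complex.normSq_eq_norm_sq, hv]; simp
  have hinv : v⁻¹ = (starRingEnd ℂ) v := inv_eq_of_mul_eq_one_right h
  rw [← Complex.normSq_eq_norm_sq, ← Complex.mul_conj, sqDistOne, hinv]
  simp only [map_sub, map_one]
  linear_combination -h

theorem sqDistOne_im (v : ℂ) : (sqDistOne v).im = -v.im * (1 - (‖v‖ ^ 2)⁻¹) := by
  simp [sqDistOne, Complex.inv_im, Complex.normSq_eq_norm_sq]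
  ring

theorem sqDistOne_ofReal {x : ℝ} (hx : x ≠ 0) : sqDistOne x = ((-(x - 1) ^ 2 / x : ℝ) : ℂ) := by
  have : (x : ℂ) ≠ 0 := by exact_mod_cast hx
  simp only [sqDistOne]
  push_cast
  field_simp
  ring

theorem sqDistOne_mem_slitPlane {v : ℂ} (hv : ¬(v.im = 0 ∧ 0 ≤ v.re)) :
    sqDistOne v ∈ Complex.slitPlane := by
  rw [Complex.mem_slitPlane_iff]
  by_cases him : (sqDistOne v).im = 0
  · left
    rw [sqDistOne_im, mul_eq_zero, neg_eq_zero] at him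
    rcases him with him | him
    · have hre : v.re < 0 := by
        by_contra! h
        exact hv ⟨him, h⟩
      have hvr : v = (v.re : ℂ) := Complex.ext (by simp) (by simp [him])
      rw [hvr, sqDistOne_ofReal hre.ne, Complex.ofReal_re]
      apply div_pos_of_neg_of_neg _ hre
      nlinarith [sq_nonneg v.re]
    · have hn : ‖v‖ = 1 := by
        have h1 : (‖v‖ ^ 2)⁻¹ = 1 := by linarith
        have h2 : ‖v‖ ^ 2 = 1 := by rwa [inv_eq_one] at h1
        exact (pow_eq_one_iff_of_nonneg (norm_nonneg v) two_ne_zero).1 h2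
      rw [sqDistOne_of_norm_eq_one hn, Complex.ofReal_re]
      have : v - 1 ≠ 0 := by
        intro h
        rw [sub_eq_zero.1 h] at hv
        simp at hv
      positivity
  · exact Or.inr him

theorem analyticAt_sqDistOne {v : ℂ} (hv : v ≠ 0) : AnalyticAt ℂ sqDistOne v := by
  unfold sqDistOne
  exact (analyticAt_const.sub analyticAt_id).sub (analyticAt_id.inv hv)

theorem tendsto_cpow_const_nhdsWithin_im_pos {y : ℂ} (hre : y.re < 0) (him : y.im = 0) (b : ℂ) :
    Tendsto (fun s : ℂ => s ^ b) (𝓝[{s | 0 < s.im}] y)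
      (𝓝 (Complex.exp ((Real.log ‖y‖ + π * Complex.I) * b))) := by
  have h := (Complex.tendsto_log_nhdsWithin_im_nonneg_of_re_neg_of_im_zero hre him).mono_left
    (nhdsWithin_mono y fun s (hs : 0 < s.im) => hs.le)
  refine ((Complex.continuous_exp.tendsto _).comp (h.mul_const b)).congr' ?_
  filter_upwards [self_mem_nhdsWithin] with s hs
  have : s ≠ 0 := by rintro rfl; exact lt_irrefl (0 : ℝ) hs
  simp [Complex.cpow_def_of_ne_zero this]

theorem tendsto_cpow_const_nhdsWithin_im_neg {y : ℂ} (hre : y.re < 0) (him : y.im = 0) (b : ℂ) :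
    Tendsto (fun s : ℂ => s ^ b) (𝓝[{s | s.im < 0}] y)
      (𝓝 (Complex.exp ((Real.log ‖y‖ - π * Complex.I) * b))) := by
  have h := Complex.tendsto_log_nhdsWithin_im_neg_of_re_neg_of_im_zero hre him
  refine ((Complex.continuous_exp.tendsto _).comp (h.mul_const b)).congr' ?_
  filter_upwards [self_mem_nhdsWithin] with s hs
  have : s ≠ 0 := by rintro rfl; exact lt_irrefl (0 : ℝ) hs
  simp [Complex.cpow_def_of_ne_zero this]

theorem eventually_im_pos_of_arg_pos {x : ℝ} (hx : 0 < x) :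
    ∀ᶠ v : ℂ in 𝓝[{v | 0 < v.arg}] (x : ℂ), 0 < v.im := by
  have h : ∀ᶠ v : ℂ in 𝓝 (x : ℂ), 0 < v.re :=
    Complex.continuous_re.continuousAt.eventually_const_lt (by simpa using hx)
  filter_upwards [self_mem_nhdsWithin, nhdsWithin_le_nhds h] with v hv hre
  refine (Complex.arg_nonneg_iff.1 (le_of_lt hv)).lt_of_ne' fun him => ?_
  have hv' : 0 < v.arg := hv
  rw [Complex.arg_eq_zero_iff.2 ⟨hre.le, him⟩] at hv'
  exact hv'.false

theorem tendsto_sqDistOne_cpow_arg_pos_of_one_lt {x : ℝ} (hx : 1 < x) (b : ℂ) :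
    Tendsto (fun v => sqDistOne v ^ b) (𝓝[{v | 0 < v.arg}] (x : ℂ))
      (𝓝 (Complex.exp ((Real.log ‖sqDistOne x‖ - π * Complex.I) * b))) ∧
    Tendsto (fun v => sqDistOne v ^ b) (𝓝[{v | v.arg < 0}] (x : ℂ))
      (𝓝 (Complex.exp ((Real.log ‖sqDistOne x‖ + π * Complex.I) * b))) := by
  have hx0 : (x : ℂ) ≠ 0 := by exact_mod_cast (by linarith : x ≠ 0)
  have hy := sqDistOne_ofReal (x := x) (by linarith)
  have hre : (sqDistOne x).re < 0 := by
    rw [hy, Complex.ofReal_re]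
    exact div_neg_of_neg_of_pos (by nlinarith) (by linarith)
  have him : (sqDistOne x).im = 0 := by rw [hy, Complex.ofReal_im]
  have hc : Tendsto sqDistOne (𝓝 (x : ℂ)) (𝓝 (sqDistOne x)) :=
    (analyticAt_sqDistOne hx0).continuousAt
  have hn : ∀ᶠ v : ℂ in 𝓝 (x : ℂ), 0 < 1 - (‖v‖ ^ 2)⁻¹ := by
    have : ∀ᶠ v : ℂ in 𝓝 (x : ℂ), 1 < ‖v‖ :=
      continuous_norm.continuousAt.eventually_const_lt
        (by simpa using hx.trans_le (le_abs_self x))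
    filter_upwards [this] with v hv
    exact sub_pos.2 (inv_lt_one_of_one_lt₀ (by nlinarith))
  constructor
  · refine (tendsto_cpow_const_nhdsWithin_im_neg hre him b).comp
      (tendsto_nhdsWithin_iff.2 ⟨hc.mono_left nhdsWithin_le_nhds, ?_⟩)
    filter_upwards [eventually_im_pos_of_arg_pos (by linarith : 0 < x), nhdsWithin_le_nhds hn]
      with v h1 h2
    rw [sqDistOne_im]
    nlinarith
  · refine (tendsto_cpow_const_nhdsWithin_im_pos hre him b).comp
      (tendsto_nhdsWithin_iff.2 ⟨hc.mono_left nhdsWithin_le_nhds, ?_⟩)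
    filter_upwards [self_mem_nhdsWithin, nhdsWithin_le_nhds hn] with v h1 h2
    have h1 : v.im < 0 := Complex.arg_neg_iff.1 h1
    rw [sqDistOne_im]
    nlinarith

theorem tendsto_sqDistOne_cpow_arg_pos_of_lt_one {x : ℝ} (hx0 : 0 < x) (hx : x < 1) (b : ℂ) :
    Tendsto (fun v => sqDistOne v ^ b) (𝓝[{v | 0 < v.arg}] (x : ℂ))
      (𝓝 (Complex.exp ((Real.log ‖sqDistOne x‖ + π * Complex.I) * b))) ∧
    Tendsto (fun v => sqDistOne v ^ b) (𝓝[{v | v.arg < 0}] (x : ℂ))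
      (𝓝 (Complex.exp ((Real.log ‖sqDistOne x‖ - π * Complex.I) * b))) := by
  have hx0' : (x : ℂ) ≠ 0 := by exact_mod_cast hx0.ne'
  have hy := sqDistOne_ofReal (x := x) (by linarith)
  have hre : (sqDistOne x).re < 0 := by
    rw [hy, Complex.ofReal_re]
    exact div_neg_of_neg_of_pos (by nlinarith) (by linarith)
  have him : (sqDistOne x).im = 0 := by rw [hy, Complex.ofReal_im]
  have hc : Tendsto sqDistOne (𝓝 (x : ℂ)) (𝓝 (sqDistOne x)) :=
    (analyticAt_sqDistOne hx0').continuousAt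
  have hn : ∀ᶠ v : ℂ in 𝓝 (x : ℂ), 1 - (‖v‖ ^ 2)⁻¹ < 0 := by
    have h1 : ∀ᶠ v : ℂ in 𝓝 (x : ℂ), ‖v‖ < 1 :=
      continuous_norm.continuousAt.eventually_lt_const
        (by simpa [abs_of_pos hx0] using hx)
    filter_upwards [h1, isOpen_ne.mem_nhds hx0'] with v hv hv0
    have : 0 < ‖v‖ := norm_pos_iff.2 hv0
    exact sub_neg.2 ((one_lt_inv₀ (by positivity)).2 (by nlinarith))
  constructor
  · refine (tendsto_cpow_const_nhdsWithin_im_pos hre him b).comp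
      (tendsto_nhdsWithin_iff.2 ⟨hc.mono_left nhdsWithin_le_nhds, ?_⟩)
    filter_upwards [eventually_im_pos_of_arg_pos hx0, nhdsWithin_le_nhds hn] with v h1 h2
    rw [sqDistOne_im]
    nlinarith
  · refine (tendsto_cpow_const_nhdsWithin_im_neg hre him b).comp
      (tendsto_nhdsWithin_iff.2 ⟨hc.mono_left nhdsWithin_le_nhds, ?_⟩)
    filter_upwards [self_mem_nhdsWithin, nhdsWithin_le_nhds hn] with v h1 h2
    have h1 : v.im < 0 := Complex.arg_neg_iff.1 h1
    rw [sqDistOne_im]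
    nlinarith

theorem mem_image_ofReal_mul_iff {a : ℂ} (ha : a ≠ 0) {X : Set ℝ} {z : ℂ} :
    z ∈ (fun t : ℝ => (t : ℂ) * a) '' X ↔ (z / a).im = 0 ∧ (z / a).re ∈ X := by
  constructor
  · rintro ⟨t, ht, rfl⟩
    simpa [ha] using ht
  · rintro ⟨h1, h2⟩
    refine ⟨_, h2, ?_⟩
    have : (((z / a).re : ℝ) : ℂ) = z / a := Complex.ext (by simp) (by simp [h1])
    simp [this, ha]

theorem abs_re_div_eq_norm {a z : ℂ} (ha : ‖a‖ = 1) (h : (z / a).im = 0) :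
    |(z / a).re| = ‖z‖ := by
  rw [Complex.abs_re_eq_norm.2 h, norm_div, ha, div_one]

theorem isClosed_ray (a : ℂ) {X : Set ℝ} (hX : IsClosed X) :
    IsClosed {z : ℂ | (z / a).im = 0 ∧ (z / a).re ∈ X} :=
  (isClosed_eq (by fun_prop) continuous_const).inter
    (hX.preimage (by fun_prop : Continuous fun z : ℂ => (z / a).re))

/-- Analytic functions agreeing on the unit circle agree on any open set that is radially connected
to the unit circle. -/
theorem eqOn_of_eqOn_unitCircle {F G : ℂ → ℂ} {A : Set ℂ} (hA : IsOpen A)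
    (hF : AnalyticOnNhd ℂ F A) (hG : AnalyticOnNhd ℂ G A)
    (hrad : ∀ z ∈ A, z ≠ 0 ∧ ∀ t ∈ uIcc ‖z‖⁻¹ 1, (t : ℂ) * z ∈ A)
    (h : ∀ z ∈ A, ‖z‖ = 1 → F z = G z) : EqOn F G A := by
  intro z hz
  obtain ⟨hz0, hseg⟩ := hrad z hz
  set U : Set ℂ := (fun t : ℝ => (t : ℂ) * z) '' uIcc ‖z‖⁻¹ 1 with hU
  have hUA : U ⊆ A := by
    rintro _ ⟨t, ht, rfl⟩
    exact hseg t ht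
  have hUc : IsPreconnected U :=
    isPreconnected_uIcc.image _ (by fun_prop : Continuous fun t : ℝ => (t : ℂ) * z).continuousOn
  set z₁ : ℂ := ((‖z‖⁻¹ : ℝ) : ℂ) * z with hz₁
  have hz₁U : z₁ ∈ U := ⟨_, left_mem_uIcc, rfl⟩
  have hz₁n : ‖z₁‖ = 1 := by
    rw [hz₁, norm_mul, Complex.norm_real, norm_inv, norm_norm,
      inv_mul_cancel₀ (norm_ne_zero_iff.2 hz0)]
  have hz₁0 : z₁ ≠ 0 := by
    rintro h0
    simp [h0] at hz₁n
  have hd : HasDerivAt (fun θ : ℝ => z₁ * Complex.exp (θ * Complex.I))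
      (z₁ * (Complex.exp (((0 : ℝ) : ℂ) * Complex.I) * Complex.I)) 0 := by
    have h1 : HasDerivAt (fun θ : ℝ => (θ : ℂ) * Complex.I) Complex.I 0 := by
      simpa using (Complex.ofRealCLM.hasDerivAt (x := (0 : ℝ))).mul_const Complex.I
    exact (h1.cexp).const_mul z₁
  have ht : Tendsto (fun θ : ℝ => z₁ * Complex.exp (θ * Complex.I)) (𝓝[≠] 0) (𝓝[≠] z₁) := by
    have := hd.tendsto_nhdsNE (by simp [hz₁0])
    simpa using this
  have hev : ∀ᶠ θ : ℝ in 𝓝[≠] 0, F (z₁ * Complex.exp (θ * Complex.I)) =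
      G (z₁ * Complex.exp (θ * Complex.I)) := by
    have h1 := (tendsto_nhds_of_tendsto_nhdsWithin ht).eventually (hA.mem_nhds (hUA hz₁U))
    filter_upwards [h1] with θ hθ
    exact h _ hθ (by rw [norm_mul, hz₁n, Complex.norm_exp_ofReal_mul_I, one_mul])
  have hfr : ∃ᶠ y in 𝓝[≠] z₁, F y = G y := ht.frequently hev.frequently
  have heq : F =ᶠ[𝓝 z₁] G :=
    ((hF _ (hUA hz₁U)).frequently_eq_iff_eventually_eq (hG _ (hUA hz₁U))).1 hfr
  exact (hF.mono hUA).eqOn_of_preconnected_of_eventuallyEq (hG.mono hUA) hUc hz₁U heq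
    ⟨1, right_mem_uIcc, by simp⟩

/-- The exponent of the Szegő function of `exp ∘ L`. -/
noncomputable def szegoExponent (L : ℂ → ℝ) (z : ℂ) : ℂ :=
  ((4 * π : ℝ)⁻¹ : ℂ) * ∫ θ in (0 : ℝ)..(2 * π), (L (Complex.exp (θ * Complex.I)) : ℂ) *
    ((Complex.exp (θ * Complex.I) + z) / (Complex.exp (θ * Complex.I) - z))

theorem exp_sub_ofReal_mul_ne_zero {z₀ : ℂ} (hz₀ : ‖z₀‖ = 1) {r : ℝ} (hr : r ∈ Ioo (0 : ℝ) 1)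
    (θ : ℝ) : Complex.exp (θ * Complex.I) - r * z₀ ≠ 0 := by
  intro h
  have h1 := congrArg norm (sub_eq_zero.1 h)
  rw [Complex.norm_exp_ofReal_mul_I, norm_mul, hz₀, Complex.norm_real, Real.norm_eq_abs,
    abs_of_pos hr.1] at h1
  linarith [hr.2]

theorem szegoExponent_reflect (L : ℂ → ℝ) {z₀ : ℂ} (hz₀ : ‖z₀‖ = 1) {r : ℝ}
    (hr : r ∈ Ioo (0 : ℝ) 1) :
    szegoExponent L (z₀ / r) = -(starRingEnd ℂ) (szegoExponent L (r * z₀)) := by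
  unfold szegoExponent
  have hint : ∀ g : ℝ → ℂ, (starRingEnd ℂ) (∫ θ in (0 : ℝ)..(2 * π), g θ) =
      ∫ θ in (0 : ℝ)..(2 * π), (starRingEnd ℂ) (g θ) := fun g => by
    simp only [intervalIntegral, map_sub, integral_conj]
  rw [map_mul, hint, ← mul_neg, ← intervalIntegral.integral_neg]
  congr 1
  · rw [map_inv₀, Complex.conj_ofReal]
  · refine intervalIntegral.integral_congr fun θ _ => ?_
    have h1 := exp_sub_ofReal_mul_ne_zero hz₀ hr θ
    have hconj : ∀ u : ℂ, ‖u‖ = 1 → (starRingEnd ℂ) u = u⁻¹ := fun u hu =>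
      (inv_eq_of_mul_eq_one_right (by
        rw [Complex.mul_conj, Complex.normSq_eq_norm_sq, hu]; simp)).symm
    have he := hconj _ (Complex.norm_exp_ofReal_mul_I θ)
    have h2 : (starRingEnd ℂ) (Complex.exp (θ * Complex.I) - r * z₀) ≠ 0 :=
      (_root_.map_ne_zero _).2 h1
    have hr0 : (r : ℂ) ≠ 0 := by exact_mod_cast hr.1.ne'
    have hz0 : z₀ ≠ 0 := by
      rintro rfl
      simp at hz₀
    have he0 := Complex.exp_ne_zero (θ * Complex.I)
    simp only [map_mul, map_div₀, map_add, map_sub, Complex.conj_ofReal, he, hconj z₀ hz₀] at h2 ⊢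
    rw [← mul_neg]
    congr 1
    generalize Complex.exp (θ * Complex.I) = e at *
    have h3 : e⁻¹ - r * z₀⁻¹ = (z₀ - r * e) / (e * z₀) := by field_simp
    have h4 : e⁻¹ + r * z₀⁻¹ = (z₀ + r * e) / (e * z₀) := by field_simp
    have h5 : z₀ - r * e ≠ 0 := by
      intro h
      rw [h3, h, zero_div] at h2
      exact h2 rfl
    have h6 : e - z₀ / r = -(z₀ - r * e) / r := by field_simp; ring
    have h7 : e + z₀ / r = (z₀ + r * e) / r := by field_simp; ring
    rw [h3, h4, h6, h7]
    field_simp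

theorem szegoExponent_re {L : ℂ → ℝ} (hL : CircleIntegrable L 0 1) {z₀ : ℂ} (hz₀ : ‖z₀‖ = 1)
    {r : ℝ} (hr : r ∈ Ioo (0 : ℝ) 1) :
    (szegoExponent L (r * z₀)).re =
      1 / 2 * Real.circleAverage (poissonKernel 0 (r * z₀) • L) 0 1 := by
  have hint : IntervalIntegrable (fun θ : ℝ => (L (Complex.exp (θ * Complex.I)) : ℂ) *
      ((Complex.exp (θ * Complex.I) + r * z₀) / (Complex.exp (θ * Complex.I) - r * z₀)))
      volume 0 (2 * π) := by
    refine IntervalIntegrable.mul_continuousOn ?_ (Continuous.continuousOn ?_)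
    · have h1 : IntervalIntegrable (fun θ : ℝ => L (Complex.exp (θ * Complex.I))) volume 0 (2 * π) := by
        simpa [CircleIntegrable, circleMap] using hL
      exact ⟨h1.1.ofReal, h1.2.ofReal⟩
    · exact Continuous.div (by fun_prop) (by fun_prop) (exp_sub_ofReal_mul_ne_zero hz₀ hr)
  unfold szegoExponent
  rw [← Complex.ofReal_inv, Complex.re_ofReal_mul]
  have h2 := (Complex.reCLM.intervalIntegral_comp_comm hint)
  simp only [Complex.reCLM_apply] at h2
  rw [← h2, Real.circleAverage_def, smul_eq_mul, ← mul_assoc]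
  congr 1
  · ring
  · refine intervalIntegral.integral_congr fun θ _ => ?_
    simp [poissonKernel_eq_re_herglotzRieszKernel, herglotzRieszKernel_def, circleMap,
      mul_comm]

/-- The logarithm of a generalized Jacobi weight is integrable on the unit circle. -/
theorem circleIntegrable_log_jacobi {m : ℕ} {a : Fin m → ℂ} {β : Fin m → ℝ} {w : ℂ → ℂ}
    (hw : ContinuousOn w (sphere 0 1)) (hw_pos : ∀ z : ℂ, ‖z‖ = 1 → 0 < (w z).re) {W : ℂ → ℝ}
    (hW : ∀ z : ℂ, ‖z‖ = 1 → W z = (w z).re * ∏ k, ‖z - a k‖ ^ (2 * β k)) :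
    CircleIntegrable (fun z => Real.log (W z)) 0 1 := by
  have h1 : CircleIntegrable (fun z => Real.log (w z).re) 0 1 := by
    refine ContinuousOn.circleIntegrable zero_le_one ?_
    exact (Complex.continuous_re.comp_continuousOn hw).log fun z hz =>
      (hw_pos z (by simpa using hz)).ne'
  have h2 : CircleIntegrable (fun z => ∑ k, (2 * β k) * Real.log ‖z - a k‖) 0 1 := by
    refine CircleIntegrable.fun_sum _ fun k _ => ?_
    exact (circleIntegrable_log_norm_sub_const 1).const_fun_smul (a := 2 * β k)
  have h3 := h1.fun_add h2
  refine IntervalIntegrable.congr_ae h3 (ae_restrict_of_ae ?_)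
  have hnull : volume ((circleMap 0 1) ⁻¹' (range a)) = 0 :=
    ((finite_range a).countable.preimage_circleMap 0 one_ne_zero).measure_zero _
  filter_upwards [compl_mem_ae_iff.2 hnull] with θ hθ
  have hn : ‖circleMap 0 1 θ‖ = 1 := by simp
  have hne : ∀ k, 0 < ‖circleMap 0 1 θ - a k‖ := fun k => by
    rw [norm_pos_iff, sub_ne_zero]
    exact fun h => hθ ⟨k, h.symm⟩
  rw [hW _ hn, Real.log_mul (hw_pos _ hn).ne'
    (Finset.prod_ne_zero_iff.2 fun k _ => (Real.rpow_pos_of_pos (hne k) _).ne'),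
    Real.log_prod fun k _ => (Real.rpow_pos_of_pos (hne k) _).ne']
  simp only [Real.log_rpow (hne _)]

/-- The two branches of the Szegő function factor the weight at its points of continuity. -/
theorem szego_boundary_factorization {L : ℂ → ℝ} {Di De : ℂ → ℂ}
    (hDi : ∀ z : ℂ, ‖z‖ < 1 → Di z = Complex.exp (szegoExponent L z))
    (hDe : ∀ z : ℂ, 1 < ‖z‖ → De z = Complex.exp (szegoExponent L z))
    (hL : CircleIntegrable L 0 1) {z₀ : ℂ} (hz₀ : ‖z₀‖ = 1)
    (hLc : ContinuousWithinAt L (sphere 0 1) z₀)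
    (hDic : ContinuousAt Di z₀) (hDec : ContinuousAt De z₀) :
    De z₀ ≠ 0 ∧ Di z₀ = De z₀ * (Real.exp (L z₀) : ℂ) := by
  have hr : Ioo (0 : ℝ) 1 ∈ 𝓝[<] (1 : ℝ) := Ioo_mem_nhdsLT zero_lt_one
  have hti : Tendsto (fun r : ℝ => Di (r * z₀)) (𝓝[<] 1) (𝓝 (Di z₀)) := by
    refine hDic.tendsto.comp (tendsto_nhdsWithin_of_tendsto_nhds ?_)
    have : Continuous fun r : ℝ => (r : ℂ) * z₀ := by fun_prop
    simpa using this.tendsto 1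
  have hte : Tendsto (fun r : ℝ => De (z₀ / r)) (𝓝[<] 1) (𝓝 (De z₀)) := by
    refine hDec.tendsto.comp (tendsto_nhdsWithin_of_tendsto_nhds ?_)
    have : ContinuousAt (fun r : ℝ => z₀ / (r : ℂ)) 1 :=
      continuousAt_const.div Complex.continuous_ofReal.continuousAt (by simp)
    simpa using this.tendsto
  have hin : ∀ r ∈ Ioo (0 : ℝ) 1, Di (r * z₀) = Complex.exp (szegoExponent L (r * z₀)) :=
    fun r hr => hDi _ (by
      rw [norm_mul, hz₀, mul_one, Complex.norm_real, Real.norm_eq_abs, abs_of_pos hr.1]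
      exact hr.2)
  have hout : ∀ r ∈ Ioo (0 : ℝ) 1, De (z₀ / r) = Complex.exp (szegoExponent L (z₀ / r)) :=
    fun r hr => hDe _ (by
      rw [norm_div, hz₀, Complex.norm_real, Real.norm_eq_abs, abs_of_pos hr.1]
      exact one_lt_one_div hr.1 hr.2)
  have hconj : De z₀ * (starRingEnd ℂ) (Di z₀) = 1 := by
    refine tendsto_nhds_unique
      (hte.mul ((Complex.continuous_conj.tendsto _).comp hti)) (tendsto_const_nhds.congr' ?_)
    filter_upwards [hr] with r hr
    rw [Function.comp_apply, hin r hr, hout r hr, ← Complex.exp_conj, ← Complex.exp_add,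
      szegoExponent_reflect L hz₀ hr, neg_add_cancel, Complex.exp_zero]
  have hnorm : ‖Di z₀‖ = Real.exp (1 / 2 * L z₀) := by
    refine tendsto_nhds_unique hti.norm (Tendsto.congr' ?_ ((Real.continuous_exp.tendsto _).comp
      ((tendsto_circleAverage_poissonKernel hL hz₀ hLc).const_mul (1 / 2))))
    filter_upwards [hr] with r hr
    rw [Function.comp_apply, hin r hr, Complex.norm_exp, szegoExponent_re hL hz₀ hr]
  have hsq : Di z₀ * (starRingEnd ℂ) (Di z₀) = (Real.exp (L z₀) : ℂ) := by
    rw [Complex.mul_conj, Complex.normSq_eq_norm_sq, hnorm, ← Real.exp_nat_mul]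
    congr 2
    push_cast
    ring
  refine ⟨fun h => by simp [h] at hconj, ?_⟩
  rw [← hsq]
  linear_combination (-Di z₀) * hconj

/-- The analytic continuation of the weight `∏ k, ‖z - a k‖ ^ (2 * β k)` off the unit circle. -/
noncomputable def jacobiFactor {m : ℕ} (a : Fin m → ℂ) (β : Fin m → ℝ) (z : ℂ) : ℂ :=
  ∏ k, sqDistOne (z / a k) ^ (β k : ℂ)

theorem jacobiFactor_of_norm_eq_one {m : ℕ} {a : Fin m → ℂ} (ha : ∀ k, ‖a k‖ = 1)
    (β : Fin m → ℝ) {z : ℂ} (hz : ‖z‖ = 1) :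
    jacobiFactor a β z = ((∏ k, ‖z - a k‖ ^ (2 * β k) : ℝ) : ℂ) := by
  rw [jacobiFactor, Complex.ofReal_prod]
  refine Finset.prod_congr rfl fun k _ => ?_
  have ha0 : a k ≠ 0 := fun h => by simpa [h] using ha k
  have hn : ‖z / a k - 1‖ = ‖z - a k‖ := by
    rw [div_sub_one ha0, norm_div, ha, div_one]
  rw [sqDistOne_of_norm_eq_one (by rw [norm_div, hz, ha, div_one]), hn,
    ← Complex.ofReal_cpow (by positivity), Real.rpow_mul (norm_nonneg _), Real.rpow_two]

theorem analyticAt_sqDistOne_div_cpow {a z b : ℂ} (h : ¬((z / a).im = 0 ∧ 0 ≤ (z / a).re)) :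
    AnalyticAt ℂ (fun z => sqDistOne (z / a) ^ b) z := by
  have h0 : z / a ≠ 0 := fun h0 => h (by simp [h0])
  have h1 : AnalyticAt ℂ (fun z => sqDistOne (z / a)) z :=
    AnalyticAt.fun_comp (g := sqDistOne) (f := fun z => z / a) (analyticAt_sqDistOne h0) (by
      simp only [div_eq_mul_inv]
      fun_prop)
  exact h1.cpow analyticAt_const (sqDistOne_mem_slitPlane h)

theorem analyticAt_jacobiFactor {m : ℕ} {a : Fin m → ℂ} (β : Fin m → ℝ) {z : ℂ}
    (h : ∀ k, ¬((z / a k).im = 0 ∧ 0 ≤ (z / a k).re)) :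
    AnalyticAt ℂ (jacobiFactor a β) z := by
  unfold jacobiFactor
  exact Finset.analyticAt_fun_prod _ fun k _ => analyticAt_sqDistOne_div_cpow (h k)

theorem sqDistOne_cpow_ne_zero {v b : ℂ} (h : ¬(v.im = 0 ∧ 0 ≤ v.re)) :
    sqDistOne v ^ b ≠ 0 := fun h0 =>
  Complex.slitPlane_ne_zero (sqDistOne_mem_slitPlane h) ((Complex.cpow_eq_zero_iff _ _).1 h0).1

theorem jacobiFactor_ne_zero {m : ℕ} {a : Fin m → ℂ} (β : Fin m → ℝ) {z : ℂ}
    (h : ∀ k, ¬((z / a k).im = 0 ∧ 0 ≤ (z / a k).re)) : jacobiFactor a β z ≠ 0 :=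
  Finset.prod_ne_zero_iff.2 fun k _ => sqDistOne_cpow_ne_zero (h k)

theorem not_mem_other_ray {m : ℕ} {a : Fin m → ℂ} (ha : ∀ k, ‖a k‖ = 1)
    (ha' : Function.Injective a) {j k : Fin m} (hjk : j ≠ k) {x : ℝ} (hx : 0 < x) :
    ¬(((x : ℂ) * a k / a j).im = 0 ∧ 0 ≤ ((x : ℂ) * a k / a j).re) := by
  rintro ⟨him, hre⟩
  have h1 := abs_re_div_eq_norm (ha j) him
  rw [abs_of_nonneg hre, norm_mul, ha, mul_one, Complex.norm_real, Real.norm_eq_abs,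
    abs_of_pos hx] at h1
  have h2 : (x : ℂ) * a k / a j = x := Complex.ext (by simpa using h1) (by simpa using him)
  have haj : a j ≠ 0 := fun h => by simpa [h] using ha j
  have hx0 : (x : ℂ) ≠ 0 := by exact_mod_cast hx.ne'
  rw [div_eq_iff haj] at h2
  exact hjk (ha' (mul_left_cancel₀ hx0 h2)).symm

/-- One-sided limits of `jacobiFactor` on the ray through `a k`, in terms of those of its `k`-th
factor. -/
theorem exists_tendsto_jacobiFactor {m : ℕ} {a : Fin m → ℂ} (ha : ∀ k, ‖a k‖ = 1)
    (ha' : Function.Injective a) (β : Fin m → ℝ) (k : Fin m) {x : ℝ} (hx : 0 < x) :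
    ∃ Q : ℂ, Q ≠ 0 ∧ ∀ (p : ℂ → Prop) (c : ℂ),
      Tendsto (fun v => sqDistOne v ^ (β k : ℂ)) (𝓝[{v | p v}] (x : ℂ)) (𝓝 c) →
      Tendsto (jacobiFactor a β) (𝓝[{z | p (z / a k)}] ((x : ℂ) * a k)) (𝓝 (c * Q)) := by
  have hak : a k ≠ 0 := fun h => by simpa [h] using ha k
  refine ⟨∏ j ∈ Finset.univ.erase k, sqDistOne ((x : ℂ) * a k / a j) ^ (β j : ℂ),
    Finset.prod_ne_zero_iff.2 fun j hj =>
      sqDistOne_cpow_ne_zero (not_mem_other_ray ha ha' (Finset.ne_of_mem_erase hj) hx), ?_⟩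
  intro p c hc
  have h1 : Tendsto (fun z => sqDistOne (z / a k) ^ (β k : ℂ))
      (𝓝[{z | p (z / a k)}] ((x : ℂ) * a k)) (𝓝 c) := by
    refine hc.comp (tendsto_nhdsWithin_iff.2 ⟨?_, self_mem_nhdsWithin⟩)
    have : Continuous fun z : ℂ => z / a k := by fun_prop
    have h2 := (this.tendsto ((x : ℂ) * a k)).mono_left
      (nhdsWithin_le_nhds (s := {z | p (z / a k)}))
    rwa [mul_div_cancel_right₀ _ hak] at h2
  have h2 : Tendsto (fun z => ∏ j ∈ Finset.univ.erase k, sqDistOne (z / a j) ^ (β j : ℂ))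
      (𝓝[{z | p (z / a k)}] ((x : ℂ) * a k))
      (𝓝 (∏ j ∈ Finset.univ.erase k, sqDistOne ((x : ℂ) * a k / a j) ^ (β j : ℂ))) := by
    refine tendsto_finsetProd _ fun j hj => ?_
    exact (analyticAt_sqDistOne_div_cpow
      (not_mem_other_ray ha ha' (Finset.ne_of_mem_erase hj) hx)).continuousAt.tendsto.mono_left
        nhdsWithin_le_nhds
  refine (h1.mul h2).congr fun z => ?_
  exact Finset.mul_prod_erase _ (fun j => sqDistOne (z / a j) ^ (β j : ℂ)) (Finset.mem_univ k)

theorem stmt16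
    (ρ : ℝ) (hρ0 : 0 < ρ) (hρ1 : ρ < 1)
    (m : ℕ) (hm : 0 < m)
    (a : Fin m → ℂ) (ha : ∀ k, ‖a k‖ = 1) (ha' : Function.Injective a)
    (β : Fin m → ℝ) (hβ : ∀ k, -(1/2 : ℝ) < β k)
    (w : ℂ → ℂ)
    (hw_an : AnalyticOn ℂ w {z : ℂ | ρ < ‖z‖ ∧ ‖z‖ < 1/ρ})
    (hw_ne : ∀ z : ℂ, ρ < ‖z‖ → ‖z‖ < 1/ρ → w z ≠ 0)
    (hw_pos : ∀ z : ℂ, ‖z‖ = 1 → 0 < (w z).re ∧ (w z).im = 0)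
    (W : ℂ → ℝ)
    (hW : ∀ z : ℂ, ‖z‖ = 1 → W z = (w z).re * ∏ k, ‖z - a k‖ ^ (2 * β k))
    (Di De : ℂ → ℂ)
    (hDi_def : ∀ z : ℂ, ‖z‖ < 1 → Di z =
      Complex.exp (((4 * π : ℝ)⁻¹ : ℂ) * ∫ θ in (0:ℝ)..(2 * π),
        (Real.log (W (Complex.exp (θ * Complex.I))) : ℂ) *
          ((Complex.exp (θ * Complex.I) + z) / (Complex.exp (θ * Complex.I) - z))))
    (hDe_def : ∀ z : ℂ, 1 < ‖z‖ → De z =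
      Complex.exp (((4 * π : ℝ)⁻¹ : ℂ) * ∫ θ in (0:ℝ)..(2 * π),
        (Real.log (W (Complex.exp (θ * Complex.I))) : ℂ) *
          ((Complex.exp (θ * Complex.I) + z) / (Complex.exp (θ * Complex.I) - z))))
    (hDi_an : AnalyticOn ℂ Di
      ({z : ℂ | ‖z‖ < 1/ρ} \ ⋃ k, (fun t : ℝ => (t : ℂ) * a k) '' Set.Ico 1 (1/ρ)))
    (hDe_an : AnalyticOn ℂ De
      ({z : ℂ | ρ < ‖z‖} \ ⋃ k, (fun t : ℝ => (t : ℂ) * a k) '' Set.Ioc ρ 1))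
    :
    (∀ k : Fin m, ∀ x : ℝ, 1 < x → x < 1 / ρ →
      ∃ Lp Lm : ℂ,
        Filter.Tendsto Di (nhdsWithin ((x : ℂ) * a k) {z : ℂ | 0 < Complex.arg (z / a k)})
          (nhds Lp) ∧
        Filter.Tendsto Di (nhdsWithin ((x : ℂ) * a k) {z : ℂ | Complex.arg (z / a k) < 0})
          (nhds Lm) ∧
        Lp = Complex.exp (((-2 * π * β k : ℝ) : ℂ) * Complex.I) * Lm) ∧
    (∀ k : Fin m, ∀ x : ℝ, ρ < x → x < 1 →
      ∃ Lp Lm : ℂ,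
        Filter.Tendsto De (nhdsWithin ((x : ℂ) * a k) {z : ℂ | 0 < Complex.arg (z / a k)})
          (nhds Lp) ∧
        Filter.Tendsto De (nhdsWithin ((x : ℂ) * a k) {z : ℂ | Complex.arg (z / a k) < 0})
          (nhds Lm) ∧
        Lp = Complex.exp (((-2 * π * β k : ℝ) : ℂ) * Complex.I) * Lm) ∧
    (∀ z : ℂ, ‖z‖ = 1 → z ∉ Set.range a → (W z : ℂ) = Di z / De z) ∧
    AnalyticOn ℂ (fun z => Di z / De z)
      ({z : ℂ | ρ < ‖z‖ ∧ ‖z‖ < 1/ρ} \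
        ⋃ k, (fun t : ℝ => (t : ℂ) * a k) '' Set.Ioo ρ (1/ρ)) := by
  set S : Set ℂ := {z : ℂ | ‖z‖ < 1/ρ} \ ⋃ k, (fun t : ℝ => (t : ℂ) * a k) '' Set.Ico 1 (1/ρ)
    with hS
  set E : Set ℂ := {z : ℂ | ρ < ‖z‖} \ ⋃ k, (fun t : ℝ => (t : ℂ) * a k) '' Set.Ioc ρ 1 with hE
  set A : Set ℂ := {z : ℂ | ρ < ‖z‖ ∧ ‖z‖ < 1/ρ} \
        ⋃ k, (fun t : ℝ => (t : ℂ) * a k) '' Set.Ioo ρ (1/ρ) with hA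
  have hρ : 1 < 1 / ρ := one_lt_one_div hρ0 hρ1
  have ha0 : ∀ k, a k ≠ 0 := fun k h => by simpa [h] using ha k
  have hSmem : ∀ z, z ∈ S ↔ ‖z‖ < 1 / ρ ∧ ∀ k, ¬((z / a k).im = 0 ∧ 1 ≤ (z / a k).re) := by
    intro z
    simp only [hS, Set.mem_sdiff, mem_iUnion, mem_image_ofReal_mul_iff (ha0 _), not_exists]
    refine and_congr_right fun hz => forall_congr' fun k => not_congr (and_congr_right fun him => ?_)
    have h1 := abs_re_div_eq_norm (ha k) him
    have hz' : ‖z‖ < 1 / ρ := hz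
    exact ⟨fun h => h.1, fun h => ⟨h, (le_abs_self _).trans_lt (h1 ▸ hz')⟩⟩
  have hEmem : ∀ z, z ∈ E ↔ ρ < ‖z‖ ∧ ∀ k, ¬((z / a k).im = 0 ∧ (z / a k).re ∈ Icc 0 1) := by
    intro z
    simp only [hE, Set.mem_sdiff, mem_iUnion, mem_image_ofReal_mul_iff (ha0 _), not_exists]
    refine and_congr_right fun hz => forall_congr' fun k => not_congr (and_congr_right fun him => ?_)
    have h1 := abs_re_div_eq_norm (ha k) him
    have hz' : ρ < ‖z‖ := hz
    refine ⟨fun h => ⟨hρ0.le.trans h.1.le, h.2⟩, fun h => ⟨?_, h.2⟩⟩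
    rw [abs_of_nonneg h.1] at h1
    rwa [h1]
  have hAmem : ∀ z, z ∈ A ↔ (ρ < ‖z‖ ∧ ‖z‖ < 1 / ρ) ∧
      ∀ k, ¬((z / a k).im = 0 ∧ 0 ≤ (z / a k).re) := by
    intro z
    simp only [hA, Set.mem_sdiff, mem_iUnion, mem_image_ofReal_mul_iff (ha0 _), not_exists]
    refine and_congr_right fun hz => forall_congr' fun k => not_congr (and_congr_right fun him => ?_)
    have h1 := abs_re_div_eq_norm (ha k) him
    have hz' : ρ < ‖z‖ ∧ ‖z‖ < 1 / ρ := hz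
    refine ⟨fun h => hρ0.le.trans h.1.le, fun h => ?_⟩
    rw [abs_of_nonneg h] at h1
    rwa [h1]
  have hAS : A ⊆ S := fun z hz => (hSmem z).2
    ⟨((hAmem z).1 hz).1.2, fun k h => ((hAmem z).1 hz).2 k ⟨h.1, zero_le_one.trans h.2⟩⟩
  have hAE : A ⊆ E := fun z hz => (hEmem z).2
    ⟨((hAmem z).1 hz).1.1, fun k h => ((hAmem z).1 hz).2 k ⟨h.1, h.2.1⟩⟩
  have hray : ∀ {X : Set ℝ}, IsClosed X →
      IsOpen (⋂ k, {z : ℂ | (z / a k).im = 0 ∧ (z / a k).re ∈ X}ᶜ) := fun hX =>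
    isOpen_iInter_of_finite fun k => (isClosed_ray (a k) hX).isOpen_compl
  have hS1 : IsOpen {z : ℂ | ‖z‖ < 1 / ρ} := isOpen_lt continuous_norm continuous_const
  have hE1 : IsOpen {z : ℂ | ρ < ‖z‖} := isOpen_lt continuous_const continuous_norm
  have hSo : IsOpen S := by
    convert hS1.inter (hray (isClosed_Ici (a := (1 : ℝ))))
      using 1
    ext z
    rw [hSmem]
    simp
  have hEo : IsOpen E := by
    convert hE1.inter
      (hray (isClosed_Icc (a := (0 : ℝ)) (b := 1))) using 1
    ext z
    rw [hEmem]
    simp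
  have hAnn : IsOpen {z : ℂ | ρ < ‖z‖ ∧ ‖z‖ < 1/ρ} :=
    hE1.inter hS1
  have hAo : IsOpen A := by
    convert hAnn.inter (hray (isClosed_Ici (a := (0 : ℝ)))) using 1
    ext z
    rw [hAmem]
    simp
  have hDiS : AnalyticOnNhd ℂ Di S := hSo.analyticOn_iff_analyticOnNhd.1 hDi_an
  have hDeE : AnalyticOnNhd ℂ De E := hEo.analyticOn_iff_analyticOnNhd.1 hDe_an
  have hwN : AnalyticOnNhd ℂ w {z : ℂ | ρ < ‖z‖ ∧ ‖z‖ < 1/ρ} :=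
    hAnn.analyticOn_iff_analyticOnNhd.1 hw_an
  have hsph : sphere (0 : ℂ) 1 ⊆ {z : ℂ | ρ < ‖z‖ ∧ ‖z‖ < 1/ρ} := fun z hz => by
    have : ‖z‖ = 1 := by simpa using hz
    exact ⟨by rw [this]; exact hρ1, by rw [this]; exact hρ⟩
  have hwc : ContinuousOn w (sphere 0 1) := hwN.continuousOn.mono hsph
  have hL : CircleIntegrable (fun z => Real.log (W z)) 0 1 :=
    circleIntegrable_log_jacobi hwc (fun z hz => (hw_pos z hz).1) hW
  have hbd : ∀ z ∈ A, ‖z‖ = 1 → De z ≠ 0 ∧ Di z = De z * (W z : ℂ) := by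
    intro z hz hz1
    have hne : ∀ k, z - a k ≠ 0 := fun k h => by
      refine ((hAmem z).1 hz).2 k ?_
      rw [sub_eq_zero.1 h, div_self (ha0 k)]
      simp
    have hWpos : 0 < W z := by
      rw [hW z hz1]
      exact mul_pos (hw_pos z hz1).1
        (Finset.prod_pos fun k _ => Real.rpow_pos_of_pos (norm_pos_iff.2 (hne k)) _)
    have hWc : ContinuousWithinAt W (sphere 0 1) z := by
      have h1 : ContinuousWithinAt (fun z => (w z).re * ∏ k, ‖z - a k‖ ^ (2 * β k))
          (sphere 0 1) z := by
        refine (Complex.continuous_re.continuousAt.comp_continuousWithinAt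
          (hwc z (by simpa using hz1))).mul (ContinuousAt.continuousWithinAt ?_)
        refine tendsto_finsetProd _ fun k _ => ?_
        exact (by fun_prop : Continuous fun z : ℂ => ‖z - a k‖).continuousAt.rpow_const
          (Or.inl (norm_ne_zero_iff.2 (hne k)))
      exact h1.congr (fun y hy => hW y (by simpa using hy)) (hW z hz1)
    have := szego_boundary_factorization (L := fun z => Real.log (W z)) hDi_def hDe_def hL hz1
      (hWc.log hWpos.ne') (hDiS z (hAS hz)).continuousAt (hDeE z (hAE hz)).continuousAt
    rwa [Real.exp_log hWpos] at this
  have hfac : EqOn Di (fun z => De z * (w z * jacobiFactor a β z)) A := by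
    refine eqOn_of_eqOn_unitCircle hAo (hDiS.mono hAS) ?_ ?_ ?_
    · intro z hz
      exact (hDeE z (hAE hz)).mul ((hwN z ((hAmem z).1 hz).1).mul
        (analyticAt_jacobiFactor β ((hAmem z).1 hz).2))
    · intro z hz
      obtain ⟨⟨h1, h2⟩, h3⟩ := (hAmem z).1 hz
      have hz0 : 0 < ‖z‖ := hρ0.trans h1
      refine ⟨norm_pos_iff.1 hz0, fun t ht => (hAmem _).2 ?_⟩
      have hmono : t * ‖z‖ ∈ uIcc 1 ‖z‖ := by
        rw [← inv_mul_cancel₀ hz0.ne']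
        rcases mem_uIcc.1 ht with h | h
        · exact mem_uIcc.2 (Or.inl ⟨by gcongr; exact h.1, by nlinarith [h.2]⟩)
        · exact mem_uIcc.2 (Or.inr ⟨by nlinarith [h.1], by gcongr; exact h.2⟩)
      have ht0 : 0 < t := by
        have : 0 < ‖z‖⁻¹ := inv_pos.2 hz0
        rcases mem_uIcc.1 ht with h | h <;> linarith [h.1]
      refine ⟨?_, fun k h => h3 k ?_⟩
      · rw [norm_mul, Complex.norm_real, Real.norm_eq_abs, abs_of_pos ht0]
        rcases mem_uIcc.1 hmono with h | h <;> constructor <;> linarith [h.1, h.2]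
      · rw [mul_div_assoc, Complex.re_ofReal_mul, Complex.im_ofReal_mul] at h
        exact ⟨(mul_eq_zero.1 h.1).resolve_left ht0.ne', nonneg_of_mul_nonneg_right h.2 ht0⟩
    · intro z hz hz1
      have hwr : w z = ((w z).re : ℂ) := Complex.ext (by simp) (by simpa using (hw_pos z hz1).2)
      rw [(hbd z hz hz1).2, hW z hz1, jacobiFactor_of_norm_eq_one ha β hz1, Complex.ofReal_mul,
        ← hwr]
  have hDe0 : ∀ z ∈ A, De z ≠ 0 := by
    intro z hz
    rcases lt_trichotomy ‖z‖ 1 with h | h | h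
    · intro h0
      have h1 := hfac hz
      simp only [h0, zero_mul, hDi_def z h] at h1
      exact Complex.exp_ne_zero _ h1
    · exact (hbd z hz h).1
    · rw [hDe_def z h]
      exact Complex.exp_ne_zero _
  have hnear : ∀ k : Fin m, ∀ x : ℝ, ρ < x → x < 1 / ρ → ∀ p : ℂ → Prop, (∀ v, p v → v.arg ≠ 0) →
      ∀ᶠ z in 𝓝[{z | p (z / a k)}] ((x : ℂ) * a k), z ∈ A := by
    intro k x hx1 hx2 p hp
    have hx0 : 0 < x := hρ0.trans hx1
    have hn : ‖(x : ℂ) * a k‖ = x := by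
      rw [norm_mul, ha, mul_one, Complex.norm_real, Real.norm_eq_abs, abs_of_pos hx0]
    have h1 : ∀ᶠ z in 𝓝 ((x : ℂ) * a k), ρ < ‖z‖ ∧ ‖z‖ < 1/ρ :=
      hAnn.mem_nhds (show ρ < ‖(x : ℂ) * a k‖ ∧ ‖(x : ℂ) * a k‖ < 1 / ρ by
        rw [hn]; exact ⟨hx1, hx2⟩)
    have h2 : ∀ᶠ z in 𝓝 ((x : ℂ) * a k), ∀ j, j ≠ k →
        ¬((z / a j).im = 0 ∧ 0 ≤ (z / a j).re) := by
      refine eventually_all.2 fun j => ?_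
      by_cases hj : j = k
      · simp [hj]
      · filter_upwards [(isClosed_ray (a j) (isClosed_Ici (a := (0 : ℝ)))).isOpen_compl.mem_nhds
          (not_mem_other_ray ha ha' hj hx0)] with z hz _ using hz
    filter_upwards [nhdsWithin_le_nhds h1, nhdsWithin_le_nhds h2, self_mem_nhdsWithin]
      with z h1 h2 h3
    refine (hAmem z).2 ⟨h1, fun j => ?_⟩
    by_cases hj : j = k
    · subst hj
      exact fun h => hp _ h3 (Complex.arg_eq_zero_iff.2 ⟨h.2, h.1⟩)
    · exact h2 j hj
  refine ⟨?_, ?_, ?_, ?_⟩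
  · intro k x hx1 hx2
    have hx0 : 0 < x := one_pos.trans hx1
    obtain ⟨Q, -, hQ⟩ := exists_tendsto_jacobiFactor ha ha' β k hx0
    obtain ⟨hp, hm⟩ := tendsto_sqDistOne_cpow_arg_pos_of_one_lt hx1 (β k)
    have hn : ‖(x : ℂ) * a k‖ = x := by
      rw [norm_mul, ha, mul_one, Complex.norm_real, Real.norm_eq_abs, abs_of_pos hx0]
    have hxE : (x : ℂ) * a k ∈ E := by
      refine (hEmem _).2 ⟨by rw [hn]; linarith, fun j h => ?_⟩
      have := abs_re_div_eq_norm (ha j) h.1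
      rw [abs_of_nonneg h.2.1, hn] at this
      linarith [h.2.2]
    have hDec := (hDeE _ hxE).continuousAt.tendsto
    have hwc := (hwN ((x : ℂ) * a k) ⟨by rw [hn]; linarith, by rw [hn]; exact hx2⟩).continuousAt.tendsto
    have hlim : ∀ (p : ℂ → Prop) (c : ℂ), (∀ v, p v → v.arg ≠ 0) →
        Tendsto (fun v => sqDistOne v ^ (β k : ℂ)) (𝓝[{v | p v}] (x : ℂ)) (𝓝 c) →
        Tendsto Di (𝓝[{z | p (z / a k)}] ((x : ℂ) * a k))
          (𝓝 (De ((x : ℂ) * a k) * (w ((x : ℂ) * a k) * (c * Q)))) := by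
      intro p c hp hc
      refine ((hDec.mono_left nhdsWithin_le_nhds).mul
        ((hwc.mono_left nhdsWithin_le_nhds).mul (hQ p c hc))).congr' ?_
      filter_upwards [hnear k x (by linarith) hx2 p hp] with z hz using (hfac hz).symm
    refine ⟨_, _, hlim (fun v => 0 < v.arg) _ (fun v hv => hv.ne') hp,
      hlim (fun v => v.arg < 0) _ (fun v hv => hv.ne) hm, ?_⟩
    have hexp : Complex.exp ((Real.log ‖sqDistOne x‖ - π * Complex.I) * β k) =
        Complex.exp (((-2 * π * β k : ℝ) : ℂ) * Complex.I) *
          Complex.exp ((Real.log ‖sqDistOne x‖ + π * Complex.I) * β k) := by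
      rw [← Complex.exp_add]
      congr 1
      push_cast
      ring
    rw [hexp]
    ring
  · intro k x hx1 hx2
    have hx0 : 0 < x := hρ0.trans hx1
    obtain ⟨Q, hQ0, hQ⟩ := exists_tendsto_jacobiFactor ha ha' β k hx0
    obtain ⟨hp, hm⟩ := tendsto_sqDistOne_cpow_arg_pos_of_lt_one hx0 hx2 (β k)
    have hn : ‖(x : ℂ) * a k‖ = x := by
      rw [norm_mul, ha, mul_one, Complex.norm_real, Real.norm_eq_abs, abs_of_pos hx0]
    have hxS : (x : ℂ) * a k ∈ S := by
      refine (hSmem _).2 ⟨by rw [hn]; linarith, fun j h => ?_⟩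
      have := abs_re_div_eq_norm (ha j) h.1
      rw [abs_of_nonneg (zero_le_one.trans h.2), hn] at this
      linarith [h.2]
    have hDic := (hDiS _ hxS).continuousAt.tendsto
    have hx3 : x < 1 / ρ := by linarith
    have hwc := (hwN ((x : ℂ) * a k) ⟨by rw [hn]; exact hx1, by rw [hn]; exact hx3⟩).continuousAt.tendsto
    have hw0 := hw_ne ((x : ℂ) * a k) (by rw [hn]; exact hx1) (by rw [hn]; exact hx3)
    have hlim : ∀ (p : ℂ → Prop) (c : ℂ), (∀ v, p v → v.arg ≠ 0) → c ≠ 0 →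
        Tendsto (fun v => sqDistOne v ^ (β k : ℂ)) (𝓝[{v | p v}] (x : ℂ)) (𝓝 c) →
        Tendsto De (𝓝[{z | p (z / a k)}] ((x : ℂ) * a k))
          (𝓝 (Di ((x : ℂ) * a k) / (w ((x : ℂ) * a k) * (c * Q)))) := by
      intro p c hp hc0 hc
      refine ((hDic.mono_left nhdsWithin_le_nhds).div
        ((hwc.mono_left nhdsWithin_le_nhds).mul (hQ p c hc))
        (mul_ne_zero hw0 (mul_ne_zero hc0 hQ0))).congr' ?_
      filter_upwards [hnear k x hx1 hx3 p hp] with z hz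
      obtain ⟨h1, h2⟩ := (hAmem z).1 hz
      rw [Pi.div_apply, hfac hz]
      exact mul_div_cancel_right₀ _ (mul_ne_zero (hw_ne z h1.1 h1.2) (jacobiFactor_ne_zero β h2))
    refine ⟨_, _, hlim (fun v => 0 < v.arg) _ (fun v hv => hv.ne') (Complex.exp_ne_zero _) hp,
      hlim (fun v => v.arg < 0) _ (fun v hv => hv.ne) (Complex.exp_ne_zero _) hm, ?_⟩
    have hexp : Complex.exp ((Real.log ‖sqDistOne x‖ - π * Complex.I) * β k) =
        Complex.exp (((-2 * π * β k : ℝ) : ℂ) * Complex.I) *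
          Complex.exp ((Real.log ‖sqDistOne x‖ + π * Complex.I) * β k) := by
      rw [← Complex.exp_add]
      congr 1
      push_cast
      ring
    have h1 := Complex.exp_ne_zero (((-2 * π * β k : ℝ) : ℂ) * Complex.I)
    have h2 := Complex.exp_ne_zero ((Real.log ‖sqDistOne x‖ + π * Complex.I) * β k)
    rw [hexp]
    field_simp
  · intro z hz hza
    have hzA : z ∈ A := by
      refine (hAmem z).2 ⟨hsph (by simpa using hz), fun k h => hza ⟨k, ?_⟩⟩
      have h1 := abs_re_div_eq_norm (ha k) h.1
      rw [abs_of_nonneg h.2, hz] at h1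
      have h2 : z / a k = 1 := Complex.ext (by simpa using h1) (by simpa using h.1)
      exact ((div_eq_one_iff_eq (ha0 k)).1 h2).symm
    obtain ⟨h0, h1⟩ := hbd z hzA hz
    rw [h1, mul_div_cancel_left₀ _ h0]
  · intro z hz
    exact ((hDiS z (hAS hz)).div (hDeE z (hAE hz)) (hDe0 z hz)).analyticWithinAt
end

section
/- The scattering function 𝒮(W;z) = D_i(W;z)·D_e(W;z) is analytic and single-valued in the cut annulus 𝔸_ρ ∖ ⋃_{k=1}^m a_k·(ρ,1/ρ), is bounded in a neighborhood of each a_k, and satisfies, with each ray a_k·(ρ,1/ρ) oriented towards infinity, the jump relation 𝒮_+(W;z) = e^{−2πiβ_k} 𝒮_−(W;z) for z ∈ a_k·(ρ,1/ρ) ∖ {a_k}, k = 1,…,m. In particular |𝒮(W;z)| is single-valued and positive on 𝔸_ρ, and |𝒮(W;z)| = 1 for z ∈ 𝕋 ∖ {a_1,…,a_m}. -/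
open scoped Real
open Filter MeasureTheory Metric Set Polynomial

/-- The Schwarz integral of a boundary function `h` on the circle of radius `R` about `0`. -/
noncomputable def schwarzIntegral (h : ℂ → ℂ) (R : ℝ) (z : ℂ) : ℂ :=
  Real.circleAverage (fun ζ => (ζ + z) / (ζ - z) * h ζ) 0 R

lemma CircleIntegrable.complex_ofReal {h : ℂ → ℝ} {c : ℂ} {R : ℝ} (hh : CircleIntegrable h c R) :
    CircleIntegrable (fun ζ => (h ζ : ℂ)) c R :=
  ⟨Integrable.ofReal hh.1, Integrable.ofReal hh.2⟩

lemma continuousOn_herglotzRiesz_sphere {R : ℝ} {z : ℂ} (hz : ‖z‖ ≠ |R|) :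
    ContinuousOn (fun ζ : ℂ => (ζ + z) / (ζ - z)) (sphere 0 |R|) := by
  refine ContinuousOn.div (by fun_prop) (by fun_prop) fun ζ hζ h => hz ?_
  rw [← sub_eq_zero.mp h]
  simpa using hζ

lemma CircleIntegrable.herglotzRiesz_mul {h : ℂ → ℂ} {R : ℝ} (hh : CircleIntegrable h 0 R)
    {z : ℂ} (hz : ‖z‖ ≠ |R|) :
    CircleIntegrable (fun ζ => (ζ + z) / (ζ - z) * h ζ) 0 R :=
  hh.continuousOn_mul (continuousOn_herglotzRiesz_sphere hz)

lemma differentiableOn_schwarzIntegral {h : ℂ → ℂ} {R : ℝ} (hR : 0 < R)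
    (hh : CircleIntegrable h 0 R) :
    DifferentiableOn ℂ (schwarzIntegral h R) (ball 0 R) := by
  have hh' : CircleIntegrable h 0 (R.toNNReal : ℝ) := by simpa [hR.le] using hh
  have key := (hasFPowerSeriesOn_cauchy_integral hh' (by simpa using hR)).analyticOnNhd
  have hdiff : DifferentiableOn ℂ (fun w => (2 * π * Complex.I : ℂ)⁻¹ •
      ∮ z in C(0, R), (z - w)⁻¹ • h z) (ball 0 R) := by
    have := key.differentiableOn
    rw [Metric.eball_coe] at this
    simpa [hR.le] using this
  refine ((hdiff.const_smul (2 : ℂ)).sub_const (Real.circleAverage h 0 R)).congr fun z hz => ?_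
  have hzR : ‖z‖ < R := by simpa using hz
  have hz' : ‖z‖ ≠ |R| := by rw [abs_of_pos hR]; exact hzR.ne
  have hne : ∀ ζ ∈ sphere (0 : ℂ) |R|, ζ - z ≠ 0 := fun ζ hζ h0 => hz' <| by
    rw [← sub_eq_zero.mp h0]; simpa using hζ
  have hint : CircleIntegrable (fun ζ => ζ / (ζ - z) * h ζ) 0 R :=
    hh.continuousOn_mul (ContinuousOn.div (by fun_prop) (by fun_prop) hne)
  have h1 : Real.circleAverage (fun ζ => ζ / (ζ - z) * h ζ) 0 R
      = (2 * π * Complex.I : ℂ)⁻¹ • ∮ ζ in C(0, R), (ζ - z)⁻¹ • h ζ := by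
    rw [Real.circleAverage_eq_circleIntegral hR.ne']
    congr 1
    refine circleIntegral.integral_congr hR.le fun ζ hζ => ?_
    have : ζ ≠ 0 := fun h0 => by simp [h0] at hζ; linarith
    simp only [sub_zero, smul_eq_mul]
    field_simp
  have h2 : schwarzIntegral h R z = Real.circleAverage
      (fun ζ => (2 : ℂ) • (ζ / (ζ - z) * h ζ) - h ζ) 0 R := by
    refine Real.circleAverage_congr_sphere fun ζ hζ => ?_
    have := hne ζ hζ
    simp only [smul_eq_mul]
    field_simp
    ring
  have hint2 : CircleIntegrable (fun ζ => (2 : ℂ) • (ζ / (ζ - z) * h ζ)) 0 R := hint.const_smul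
  rw [h2, Real.circleAverage_fun_sub hint2 hh, Real.circleAverage_fun_smul, h1]
  rfl

lemma schwarzIntegral_reflect (h : ℂ → ℝ) {z : ℂ} (hz : z ≠ 0) :
    schwarzIntegral (fun ζ => (h ζ : ℂ)) 1 z
      = -starRingEnd ℂ (schwarzIntegral (fun ζ => (h ζ : ℂ)) 1 (1 / starRingEnd ℂ z)) := by
  simp only [schwarzIntegral, Real.circleAverage_def, Complex.real_smul, map_mul,
    Complex.conj_ofReal]
  rw [← intervalIntegral.intervalIntegral_conj, ← mul_neg, ← intervalIntegral.integral_neg]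
  congr 1
  refine intervalIntegral.integral_congr fun θ _ => ?_
  have hn : ‖circleMap 0 1 θ‖ = 1 := by simp
  set ζ := circleMap 0 1 θ
  have hζ : ζ ≠ 0 := fun h0 => by simp [h0] at hn
  have hc : starRingEnd ℂ ζ = ζ⁻¹ := by
    rw [Complex.inv_def, Complex.normSq_eq_norm_sq, hn]; simp
  simp only [map_mul, map_div₀, map_add, map_sub, Complex.conj_conj, hc, Complex.conj_ofReal,
    map_one]
  by_cases hzz : ζ = z
  · simp [hzz]
  have h1 : ζ - z ≠ 0 := sub_ne_zero.mpr hzz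
  have h2 : ζ⁻¹ - 1 / z ≠ 0 := by
    rw [one_div, sub_ne_zero]; exact fun h => hzz (inv_injective h)
  rw [← neg_mul]
  congr 1
  rw [div_eq_iff h1, ← neg_div, div_mul_eq_mul_div, eq_div_iff h2]
  field_simp
  ring

lemma circleAverage_herglotzRiesz_of_norm_lt {R : ℝ} {z : ℂ} (hz : ‖z‖ < R) :
    Real.circleAverage (fun ζ => (ζ + z) / (ζ - z)) 0 R = 1 := by
  have hR : 0 < R := (norm_nonneg z).trans_lt hz
  have hz' : ‖z‖ ≠ |R| := by rw [abs_of_pos hR]; exact hz.ne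
  have hne : ∀ ζ ∈ sphere (0 : ℂ) |R|, ζ - z ≠ 0 := fun ζ hζ h0 => hz' <| by
    rw [← sub_eq_zero.mp h0]; simpa using hζ
  have hint : CircleIntegrable (fun ζ => ζ / (ζ - z)) 0 R :=
    (ContinuousOn.div (by fun_prop) (by fun_prop) hne).circleIntegrable'
  have h1 : Real.circleAverage (fun ζ => ζ / (ζ - z)) 0 R = 1 := by
    have := DiffContOnCl.circleAverage_smul_div (f := fun _ => (1 : ℂ)) (c := 0) (R := R) (w := z)
      diffContOnCl_const (by simpa [abs_of_pos hR] using hz)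
    simpa using this
  have h2 : Real.circleAverage (fun ζ => (ζ + z) / (ζ - z)) 0 R = Real.circleAverage
      (fun ζ => (2 : ℂ) • (ζ / (ζ - z)) - 1) 0 R := by
    refine Real.circleAverage_congr_sphere fun ζ hζ => ?_
    have := hne ζ hζ
    simp only [smul_eq_mul]
    field_simp
    ring
  have hint2 : CircleIntegrable (fun ζ => (2 : ℂ) • (ζ / (ζ - z))) 0 R := hint.const_smul
  rw [h2, Real.circleAverage_fun_sub hint2 (circleIntegrable_const _ _ _),
    Real.circleAverage_fun_smul, h1, Real.circleAverage_const]
  norm_num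

lemma circleAverage_herglotzRiesz_of_lt_norm {R : ℝ} {z : ℂ} (hR : 0 ≤ R) (hz : R < ‖z‖) :
    Real.circleAverage (fun ζ => (ζ + z) / (ζ - z)) 0 R = -1 := by
  have hz0 : z ≠ 0 := fun h => by simp [h] at hz; linarith
  have hd : DifferentiableOn ℂ (fun ζ => (ζ + z) / (ζ - z)) (closedBall 0 |R|) := by
    refine DifferentiableOn.div (by fun_prop) (by fun_prop) fun ζ hζ h0 => ?_
    rw [sub_eq_zero.mp h0, mem_closedBall, dist_zero_right, abs_of_nonneg hR] at hζ
    linarith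
  rw [DiffContOnCl.circleAverage
    (DifferentiableOn.diffContOnCl (hd.mono closure_ball_subset_closedBall))]
  simp [hz0]

lemma circleAverage_eq_of_differentiableOn_annulus {f : ℂ → ℂ} {r R : ℝ} (hr : 0 < r)
    (hrR : r ≤ R) {s : Set ℂ} (hs : IsOpen s) (hsub : closedBall 0 R \ ball 0 r ⊆ s)
    (hf : DifferentiableOn ℂ f s) :
    Real.circleAverage f 0 R = Real.circleAverage f 0 r := by
  rw [Real.circleAverage_eq_circleIntegral hr.ne',
    Real.circleAverage_eq_circleIntegral (hr.trans_le hrR).ne']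
  rw [Complex.circleIntegral_sub_center_inv_smul_eq_of_differentiable_on_annulus_off_countable hr
    hrR countable_empty (hf.continuousOn.mono hsub) fun z hz => ?_]
  refine hf.differentiableAt (hs.mem_nhds (hsub ⟨ball_subset_closedBall hz.1.1, fun h => ?_⟩))
  exact hz.1.2 (ball_subset_closedBall h)

/-- Enlarging the circle of a Schwarz integral past an outer point adds a residue. -/
lemma schwarzIntegral_residue {h : ℂ → ℂ} {R : ℝ} {s : Set ℂ} (hs : IsOpen s)
    (hsub : closedBall 0 R \ ball 0 1 ⊆ s) (hh : DifferentiableOn ℂ h s) {z : ℂ}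
    (hz1 : 1 < ‖z‖) (hzR : ‖z‖ < R) :
    schwarzIntegral h R z = schwarzIntegral h 1 z + 2 * h z := by
  have hR : 1 < R := hz1.trans hzR
  have hzs : z ∈ s := hsub ⟨by simpa using hzR.le, by simpa using hz1.le⟩
  have hsph : ∀ r : ℝ, 1 ≤ r → r ≤ R → sphere (0 : ℂ) |r| ⊆ s := fun r h1 h2 ζ hζ => by
    have : ‖ζ‖ = r := by simpa [abs_of_pos (zero_lt_one.trans_le h1)] using hζ
    exact hsub ⟨by simpa [this] using h2, by simpa [this] using h1⟩
  have hint : ∀ r : ℝ, 1 ≤ r → r ≤ R → CircleIntegrable h 0 r := fun r h1 h2 =>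
    (hh.continuousOn.mono (hsph r h1 h2)).circleIntegrable'
  have hd : DifferentiableOn ℂ (fun ζ => (ζ + z) * dslope h z ζ) s :=
    DifferentiableOn.mul (by fun_prop) ((Complex.differentiableOn_dslope (hs.mem_nhds hzs)).mpr hh)
  have heq : ∀ r : ℝ, 1 ≤ r → r ≤ R → ‖z‖ ≠ r →
      Real.circleAverage (fun ζ => (ζ + z) * dslope h z ζ) 0 r
        = schwarzIntegral h r z - h z * Real.circleAverage (fun ζ => (ζ + z) / (ζ - z)) 0 r := by
    intro r h1 h2 hzr
    have hr : |r| = r := abs_of_pos (zero_lt_one.trans_le h1)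
    have hzr' : ‖z‖ ≠ |r| := by rwa [hr]
    have hc := continuousOn_herglotzRiesz_sphere hzr'
    have hint2 : CircleIntegrable (fun ζ => h z • ((ζ + z) / (ζ - z))) 0 r :=
      hc.circleIntegrable'.const_smul
    rw [schwarzIntegral, ← smul_eq_mul (h z), ← Real.circleAverage_fun_smul,
      ← Real.circleAverage_fun_sub ((hint r h1 h2).herglotzRiesz_mul hzr')
        hint2]
    refine Real.circleAverage_congr_sphere fun ζ hζ => ?_
    have hne : ζ ≠ z := fun h0 => hzr' <| by rw [← h0]; simpa using hζ
    have : ζ - z ≠ 0 := sub_ne_zero.mpr hne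
    simp only [dslope_of_ne _ hne, slope_def_field, smul_eq_mul]
    field_simp
  have := circleAverage_eq_of_differentiableOn_annulus one_pos hR.le hs hsub hd
  rw [heq R hR.le le_rfl hzR.ne, heq 1 le_rfl hR.le hz1.ne',
    circleAverage_herglotzRiesz_of_norm_lt hzR,
    circleAverage_herglotzRiesz_of_lt_norm zero_le_one hz1] at this
  linear_combination this

lemma schwarzIntegral_eq_of_norm_lt {h : ℂ → ℂ} {R : ℝ} (hR : 1 ≤ R) {s : Set ℂ} (hs : IsOpen s)
    (hsub : closedBall 0 R \ ball 0 1 ⊆ s) (hh : DifferentiableOn ℂ h s) {z : ℂ}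
    (hz1 : ‖z‖ < 1) :
    schwarzIntegral h R z = schwarzIntegral h 1 z := by
  refine circleAverage_eq_of_differentiableOn_annulus one_pos hR
    (hs.inter (isOpen_ne (x := z))) (fun ζ hζ => ⟨hsub hζ, fun h0 => hζ.2 ?_⟩) ?_
  · rw [h0]; simpa using hz1
  · refine DifferentiableOn.mul (DifferentiableOn.div (by fun_prop) (by fun_prop) ?_)
      (hh.mono inter_subset_left)
    exact fun ζ hζ => sub_ne_zero.mpr hζ.2

lemma schwarzIntegral_log_norm_sub {a z : ℂ} (ha : ‖a‖ = 1) (hz : ‖z‖ < 1) :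
    schwarzIntegral (fun ζ => (Real.log ‖ζ - a‖ : ℂ)) 1 z = Complex.log (1 - z / a) := by
  have ha0 : a ≠ 0 := fun h => by simp [h] at ha
  have hint : CircleIntegrable (fun ζ => (Real.log ‖ζ - a‖ : ℂ)) 0 1 :=
    (circleIntegrable_log_norm_sub_const (a := a) (c := 0) 1).complex_ofReal
  have hJ := differentiableOn_schwarzIntegral one_pos hint
  have hmem : ∀ z ∈ ball (0 : ℂ) 1, 1 - z / a ∈ Complex.slitPlane := fun z hz => by
    suffices h : ‖-(z / a)‖ < 1 by
      simpa [sub_eq_add_neg] using Complex.mem_slitPlane_of_norm_lt_one h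
    simpa [ha] using hz
  have hL : DifferentiableOn ℂ (fun z => Complex.log (1 - z / a)) (ball 0 1) :=
    DifferentiableOn.clog (by fun_prop) hmem
  have hre : ∀ z ∈ ball (0 : ℂ) 1,
      (schwarzIntegral (fun ζ => (Real.log ‖ζ - a‖ : ℂ)) 1 z - Complex.log (1 - z / a)).re = 0 := by
    intro z hz
    have hz' : ‖z‖ ≠ |1| := by simp at hz ⊢; exact hz.ne
    have h1 := circleAverage_re_herglotzRieszKernel_mul_log (ρ := a) (c := 0) (R := 1) (w := z)
      (by simpa using ha) hz
    have h2 := Complex.reCLM.circleAverage_comp_comm (hint.herglotzRiesz_mul hz')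
    have h3 : (schwarzIntegral (fun ζ => (Real.log ‖ζ - a‖ : ℂ)) 1 z).re = Real.log ‖z - a‖ := by
      rw [← h1]
      refine Eq.trans h2.symm ?_
      congr 1
      ext ζ
      simp [herglotzRieszKernel_def]
    rw [Complex.sub_re, h3, Complex.log_re, sub_eq_zero]
    congr 1
    rw [one_sub_div ha0, norm_div, ha, div_one, norm_sub_rev]
  have han : AnalyticOnNhd ℂ (fun z => schwarzIntegral (fun ζ => (Real.log ‖ζ - a‖ : ℂ)) 1 z
      - Complex.log (1 - z / a)) (ball 0 1) := (hJ.sub hL).analyticOnNhd isOpen_ball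
  obtain ⟨c, hc⟩ := han.eq_const_of_re_eq_const hre isOpen_ball
    ⟨⟨0, by simp⟩, (convex_ball (0 : ℂ) 1).isPreconnected⟩
  have h0 : schwarzIntegral (fun ζ => (Real.log ‖ζ - a‖ : ℂ)) 1 0 = 0 := by
    have h1 := circleAverage_log_norm_sub_const₁ ha
    have h2 := Complex.ofRealCLM.circleAverage_comp_comm
      (circleIntegrable_log_norm_sub_const (a := a) (c := 0) 1)
    rw [h1] at h2
    rw [← Complex.ofReal_zero]
    refine Eq.trans (Real.circleAverage_congr_sphere fun ζ hζ => ?_) h2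
    have : ζ ≠ 0 := fun h => by simp [h] at hζ
    simp [this]
  have hc0 := hc 0 (by simp)
  have hcz := hc z (by simpa using hz)
  simp only [h0] at hc0
  simp at hc0
  rw [← hc0] at hcz
  exact sub_eq_zero.mp hcz

/-- The Szegő function of a zero-free analytic weight on an annulus, positive on the unit circle,
continues analytically and without zeros to the outer radius of the annulus. -/
lemma exists_outer_continuation {ρ : ℝ} (hρ0 : 0 < ρ) (hρ1 : ρ < 1) {w : ℂ → ℂ}
    (hw : DifferentiableOn ℂ w {z : ℂ | ρ < ‖z‖ ∧ ‖z‖ < 1/ρ})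
    (hw_ne : ∀ z : ℂ, ρ < ‖z‖ → ‖z‖ < 1/ρ → w z ≠ 0)
    (hw_pos : ∀ z : ℂ, ‖z‖ = 1 → 0 < (w z).re ∧ (w z).im = 0) :
    ∃ G : ℂ → ℂ, (∀ z, ‖z‖ < 1/ρ → DifferentiableAt ℂ G z) ∧ (∀ z, ‖z‖ < 1/ρ → G z ≠ 0) ∧
      ∀ z, ‖z‖ < 1 →
        G z = Complex.exp (schwarzIntegral (fun ζ => (Real.log (w ζ).re : ℂ)) 1 z / 2) := by
  have hρ' : 1 < 1/ρ := (one_lt_div hρ0).mpr hρ1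
  set A : Set ℂ := {z : ℂ | ρ < ‖z‖ ∧ ‖z‖ < 1/ρ} with hA
  have hAo : IsOpen A :=
    (isOpen_lt continuous_const continuous_norm).inter (isOpen_lt continuous_norm continuous_const)
  set s : Set ℂ := A ∩ w ⁻¹' {z | 0 < z.re} with hs_def
  have hs : IsOpen s :=
    hw.continuousOn.isOpen_inter_preimage hAo (isOpen_lt continuous_const Complex.continuous_re)
  have hsph : sphere (0 : ℂ) 1 ⊆ s := fun ζ hζ => by
    have : ‖ζ‖ = 1 := by simpa using hζ
    exact ⟨⟨by linarith, by linarith⟩, (hw_pos ζ this).1⟩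
  obtain ⟨δ, hδ, hthick⟩ := (isCompact_sphere (0 : ℂ) 1).exists_thickening_subset_open hs hsph
  set R : ℝ := 1 + δ / 2 with hR_def
  have hR1 : 1 < R := by linarith
  have hsub : closedBall 0 R \ ball 0 1 ⊆ s := by
    rintro ζ ⟨h1, h2⟩
    have h1 : ‖ζ‖ ≤ R := by simpa using h1
    have h2 : 1 ≤ ‖ζ‖ := by simpa using h2
    have hpos : (0 : ℝ) < ‖ζ‖ := by linarith
    apply hthick
    rw [mem_thickening_iff]
    refine ⟨ζ / ‖ζ‖, by simp [hpos.ne'], ?_⟩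
    have : ζ - ζ / ‖ζ‖ = ((1 - 1 / ‖ζ‖ : ℝ) : ℂ) * ζ := by push_cast; ring
    rw [dist_eq_norm, this, norm_mul, Complex.norm_real, Real.norm_eq_abs,
      abs_of_nonneg (by rw [sub_nonneg]; exact (div_le_one hpos).mpr h2), sub_mul,
      one_div, inv_mul_cancel₀ hpos.ne']
    linarith
  set h : ℂ → ℂ := fun z => Complex.log (w z) with hh_def
  have hh : DifferentiableOn ℂ h s :=
    (hw.mono inter_subset_left).clog fun z hz => Or.inl hz.2
  set h₀ : ℂ → ℝ := fun ζ => Real.log (w ζ).re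
  have hh₀ : ∀ ζ ∈ sphere (0 : ℂ) |1|, h ζ = (h₀ ζ : ℂ) := fun ζ hζ => by
    obtain ⟨h1, h2⟩ := hw_pos ζ (by simpa using hζ)
    have : w ζ = ((w ζ).re : ℂ) := Complex.ext rfl (by simp [h2])
    simp only [hh_def, h₀]
    rw [this, Complex.ofReal_re, Complex.ofReal_log h1.le]
  set J : ℂ → ℂ := schwarzIntegral (fun ζ => (h₀ ζ : ℂ)) 1 with hJ_def
  have hJh : ∀ z, schwarzIntegral h 1 z = J z := fun z =>
    Real.circleAverage_congr_sphere fun ζ hζ => by simp only [hh₀ ζ hζ]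
  have hint : ∀ r : ℝ, 1 ≤ r → r ≤ R → CircleIntegrable h 0 r := fun r h1 h2 => by
    refine (hh.continuousOn.mono fun ζ hζ => ?_).circleIntegrable'
    have : ‖ζ‖ = r := by simpa [abs_of_pos (zero_lt_one.trans_le h1)] using hζ
    exact hsub ⟨by simpa [this] using h2, by simpa [this] using h1⟩
  have hJR : DifferentiableOn ℂ (schwarzIntegral h R) (ball 0 R) :=
    differentiableOn_schwarzIntegral (by linarith) (hint R hR1.le le_rfl)
  have hJ1 : DifferentiableOn ℂ J (ball 0 1) :=
    (differentiableOn_schwarzIntegral one_pos (hint 1 le_rfl hR1.le)).congr fun z _ => (hJh z).symm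
  set G₁ : ℂ → ℂ := fun z => Complex.exp (schwarzIntegral h R z / 2)
  set G₂ : ℂ → ℂ := fun z =>
    w z * Complex.exp (-(starRingEnd ℂ ∘ J ∘ starRingEnd ℂ) z⁻¹ / 2) with hG₂
  have hagree : ∀ z, 1 < ‖z‖ → ‖z‖ < R → G₁ z = G₂ z := fun z h1 h2 => by
    have hz0 : z ≠ 0 := fun h0 => by simp [h0] at h1; linarith
    have hzs : z ∈ s := hsub ⟨by simpa using h2.le, by simpa using h1.le⟩
    have hwz : w z ≠ 0 := hw_ne z hzs.1.1 hzs.1.2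
    have hc : (starRingEnd ℂ ∘ J ∘ starRingEnd ℂ) z⁻¹ = starRingEnd ℂ (J (1 / starRingEnd ℂ z)) := by
      simp
    have hJr : J z = -starRingEnd ℂ (J (1 / starRingEnd ℂ z)) := schwarzIntegral_reflect h₀ hz0
    simp only [G₁, hG₂]
    rw [schwarzIntegral_residue hs hsub hh h1 h2, hJh, hc, ← hJr, add_div,
      Complex.exp_add, mul_div_cancel_left₀ _ two_ne_zero, Complex.exp_log hwz, mul_comm]
  classical
  refine ⟨fun z => if ‖z‖ < R then G₁ z else G₂ z, fun z hz => ?_, fun z hz => ?_, fun z hz => ?_⟩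
  · by_cases hzR : ‖z‖ < R
    · have h1 : DifferentiableAt ℂ G₁ z :=
        ((hJR.differentiableAt (isOpen_ball.mem_nhds (by simpa using hzR))).div_const 2).cexp
      refine h1.congr_of_eventuallyEq ?_
      filter_upwards [(isOpen_lt continuous_norm continuous_const).mem_nhds hzR] with y hy
      exact if_pos hy
    · have hz1 : 1 < ‖z‖ := by linarith [not_lt.mp hzR]
      have hz0 : z ≠ 0 := fun h0 => by simp [h0] at hz1; linarith
      have hJc : DifferentiableAt ℂ (starRingEnd ℂ ∘ J ∘ starRingEnd ℂ) z⁻¹ := by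
        have : DifferentiableAt ℂ J (starRingEnd ℂ z⁻¹) := by
          refine hJ1.differentiableAt (isOpen_ball.mem_nhds ?_)
          simpa using inv_lt_one_of_one_lt₀ hz1
        simpa using this.conj_conj
      have h2 : DifferentiableAt ℂ G₂ z := by
        refine DifferentiableAt.mul (hw.differentiableAt (hAo.mem_nhds ⟨by linarith, hz⟩)) ?_
        refine DifferentiableAt.cexp (DifferentiableAt.div_const (DifferentiableAt.neg ?_) 2)
        exact hJc.comp z (differentiableAt_inv hz0)
      refine h2.congr_of_eventuallyEq ?_
      filter_upwards [(isOpen_lt continuous_const continuous_norm).mem_nhds hz1] with y hy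
      split_ifs with hyR
      · exact hagree y hy hyR
      · rfl
  · dsimp only
    split_ifs with hzR
    · exact Complex.exp_ne_zero _
    · exact mul_ne_zero (hw_ne z (by linarith [not_lt.mp hzR]) hz) (Complex.exp_ne_zero _)
  · dsimp only
    rw [if_pos (hz.trans hR1)]
    simp only [G₁]
    rw [schwarzIntegral_eq_of_norm_lt hR1.le hs hsub hh hz, hJh]

lemma exp_schwarzIntegral_weight {m : ℕ} {a : Fin m → ℂ} (ha : ∀ k, ‖a k‖ = 1) (β : Fin m → ℝ)
    {v W : ℂ → ℝ} (hv : ContinuousOn v (sphere 0 1)) (hv_pos : ∀ z : ℂ, ‖z‖ = 1 → 0 < v z)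
    (hW : ∀ z : ℂ, ‖z‖ = 1 → W z = v z * ∏ k, ‖z - a k‖ ^ (2 * β k)) {z : ℂ} (hz : ‖z‖ < 1) :
    Complex.exp (schwarzIntegral (fun ζ => (Real.log (W ζ) : ℂ)) 1 z / 2)
      = Complex.exp (schwarzIntegral (fun ζ => (Real.log (v ζ) : ℂ)) 1 z / 2) *
        ∏ k, Complex.exp (β k * Complex.log (1 - z / a k)) := by
  have hz' : ‖z‖ ≠ |1| := by simpa using hz.ne
  have hiv : CircleIntegrable (fun ζ => (Real.log (v ζ) : ℂ)) 0 1 :=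
    CircleIntegrable.complex_ofReal (h := fun ζ => Real.log (v ζ)) <|
      ContinuousOn.circleIntegrable zero_le_one
        (hv.log fun ζ hζ => (hv_pos ζ (by simpa using hζ)).ne')
  have hia : ∀ k, CircleIntegrable (fun ζ => (Real.log ‖ζ - a k‖ : ℂ)) 0 1 := fun k =>
    (circleIntegrable_log_norm_sub_const (a := a k) (c := 0) 1).complex_ofReal
  have hia' : ∀ k, CircleIntegrable
      (fun ζ => (2 * β k : ℂ) • ((ζ + z) / (ζ - z) * (Real.log ‖ζ - a k‖ : ℂ))) 0 1 := fun k =>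
    ((hia k).herglotzRiesz_mul hz').const_smul
  have key : schwarzIntegral (fun ζ => (Real.log (W ζ) : ℂ)) 1 z
      = schwarzIntegral (fun ζ => (Real.log (v ζ) : ℂ)) 1 z
        + ∑ k, (2 * β k : ℂ) * Complex.log (1 - z / a k) := by
    have h1 : schwarzIntegral (fun ζ => (Real.log (W ζ) : ℂ)) 1 z =
        Real.circleAverage (fun ζ => (ζ + z) / (ζ - z) * (Real.log (v ζ) : ℂ) +
          ∑ k, (2 * β k : ℂ) • ((ζ + z) / (ζ - z) * (Real.log ‖ζ - a k‖ : ℂ))) 0 1 := by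
      refine Real.circleAverage_congr_codiscreteWithin ?_ one_ne_zero
      have hfin : (range a)ᶜ ∈ codiscreteWithin (sphere (0 : ℂ) |1|) :=
        compl_finite_mem_codiscreteWithin (Set.finite_range a)
      filter_upwards [hfin, self_mem_codiscreteWithin _] with ζ hζa hζ
      have hn : ‖ζ‖ = 1 := by simpa using hζ
      have hne : ∀ k, ‖ζ - a k‖ ≠ 0 := fun k h0 =>
        hζa ⟨k, (sub_eq_zero.mp (norm_eq_zero.mp h0)).symm⟩
      rw [hW ζ hn, Real.log_mul (hv_pos ζ hn).ne' (Finset.prod_ne_zero_iff.mpr fun k _ =>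
        (Real.rpow_pos_of_pos ((norm_nonneg _).lt_of_ne' (hne k)) _).ne'),
        Real.log_prod fun k _ => (Real.rpow_pos_of_pos ((norm_nonneg _).lt_of_ne' (hne k)) _).ne']
      simp only [Real.log_rpow ((norm_nonneg _).lt_of_ne' (hne _))]
      push_cast
      rw [mul_add, Finset.mul_sum]
      congr 1
      refine Finset.sum_congr rfl fun k _ => ?_
      simp only [smul_eq_mul]
      ring
    rw [h1, Real.circleAverage_fun_add (hiv.herglotzRiesz_mul hz')
      (CircleIntegrable.fun_sum _ fun k _ => hia' k), Real.circleAverage_fun_sum fun k _ => hia' k]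
    congr 1
    refine Finset.sum_congr rfl fun k _ => ?_
    rw [Real.circleAverage_fun_smul, smul_eq_mul, ← schwarzIntegral_log_norm_sub (ha k) hz]
    rfl
  rw [key, add_div, Complex.exp_add, Finset.sum_div, Complex.exp_sum]
  congr 1
  refine Finset.prod_congr rfl fun k _ => ?_
  congr 1
  ring

lemma Complex.one_sub_ofReal_mul_mem_slitPlane {ζ : ℂ} (hζ : -ζ ∈ Complex.slitPlane) {t : ℝ}
    (ht : 0 ≤ t) : 1 - t * ζ ∈ Complex.slitPlane := by
  rw [Complex.mem_slitPlane_iff] at hζ ⊢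
  simp only [Complex.neg_re, Complex.neg_im, ne_eq, neg_eq_zero] at hζ
  simp only [Complex.sub_re, Complex.one_re, Complex.re_ofReal_mul, Complex.sub_im, Complex.one_im,
    Complex.im_ofReal_mul, zero_sub, ne_eq, neg_eq_zero, mul_eq_zero]
  rcases ht.eq_or_lt with rfl | ht
  · simp
  · rcases hζ with h | h
    · left; nlinarith
    · right; simp [ht.ne', h]

lemma Complex.one_sub_mem_slitPlane_of_neg_mem {ζ : ℂ} (hζ : -ζ ∈ Complex.slitPlane) :
    1 - ζ ∈ Complex.slitPlane := by
  simpa using Complex.one_sub_ofReal_mul_mem_slitPlane hζ zero_le_one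

lemma Complex.neg_inv_mem_slitPlane {ζ : ℂ} (hζ : -ζ ∈ Complex.slitPlane) :
    -ζ⁻¹ ∈ Complex.slitPlane := by
  have hζ0 : ζ ≠ 0 := fun h => by simp [h] at hζ
  have hn : 0 < Complex.normSq ζ := Complex.normSq_pos.mpr hζ0
  rw [Complex.mem_slitPlane_iff] at hζ ⊢
  simp only [Complex.neg_re, Complex.neg_im, ne_eq, neg_eq_zero] at hζ
  simp only [Complex.neg_re, Complex.neg_im, Complex.inv_re, Complex.inv_im]
  rcases hζ with h | h
  · left; rw [← neg_div]; exact div_pos h hn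
  · right; simp [hn.ne', h]

lemma Complex.neg_conj_mem_slitPlane {ζ : ℂ} (hζ : -ζ ∈ Complex.slitPlane) :
    -starRingEnd ℂ ζ ∈ Complex.slitPlane := by
  simpa [Complex.mem_slitPlane_iff] using hζ

lemma Complex.ofReal_mul_mem_slitPlane {ζ : ℂ} (hζ : ζ ∈ Complex.slitPlane) {t : ℝ} (ht : 0 < t) :
    t * ζ ∈ Complex.slitPlane := by
  rw [Complex.mem_slitPlane_iff] at hζ ⊢
  simpa [Complex.re_ofReal_mul, Complex.im_ofReal_mul, ht, ht.ne'] using hζ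

/-- A point off the negative of the slit plane lies on the closed positive ray. -/
lemma Complex.eq_norm_of_neg_notMem_slitPlane {ζ : ℂ} (hζ : -ζ ∉ Complex.slitPlane) :
    ζ = (‖ζ‖ : ℂ) := by
  rw [Complex.mem_slitPlane_iff] at hζ
  push Not at hζ
  obtain ⟨h1, h2⟩ := hζ
  simp only [Complex.neg_re, Complex.neg_im, neg_eq_zero] at h1 h2
  have : ζ = (ζ.re : ℂ) := Complex.ext rfl (by simpa using h2)
  conv_rhs => rw [this, Complex.norm_real, Real.norm_eq_abs, abs_of_nonneg (by linarith)]
  exact this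

lemma Complex.log_one_sub_sub_log_one_sub_inv {ζ : ℂ} (hζ : ζ.im ≠ 0) :
    Complex.log (1 - ζ) - Complex.log (1 - ζ⁻¹) = Complex.log (-ζ) := by
  have hζ0 : ζ ≠ 0 := fun h => hζ (by simp [h])
  have hn : 0 < Complex.normSq ζ := Complex.normSq_pos.mpr hζ0
  have him : (1 - ζ⁻¹).im = ζ.im / Complex.normSq ζ := by
    simp [Complex.inv_im, neg_div]
  have hne : 1 - ζ⁻¹ ≠ 0 := fun h => by
    rw [h, Complex.zero_im, eq_comm, div_eq_zero_iff] at him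
    exact him.elim hζ hn.ne'
  have hmul : 1 - ζ = -ζ * (1 - ζ⁻¹) := by
    rw [mul_sub, neg_mul ζ ζ⁻¹, mul_inv_cancel₀ hζ0]; ring
  rw [hmul, (Complex.log_mul_eq_add_log_iff (neg_ne_zero.mpr hζ0) hne).mpr, add_sub_cancel_right]
  have b1 := Complex.neg_pi_lt_arg (-ζ)
  have b2 := Complex.arg_le_pi (-ζ)
  have b3 := Complex.neg_pi_lt_arg (1 - ζ⁻¹)
  have b4 := Complex.arg_le_pi (1 - ζ⁻¹)
  rcases lt_or_gt_of_ne hζ with h | h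
  · have h1 : 0 ≤ Complex.arg (-ζ) := Complex.arg_nonneg_iff.mpr (by simpa using h.le)
    have h2 : Complex.arg (1 - ζ⁻¹) < 0 :=
      Complex.arg_neg_iff.mpr (by rw [him]; exact div_neg_of_neg_of_pos h hn)
    constructor <;> linarith
  · have h1 : Complex.arg (-ζ) < 0 := Complex.arg_neg_iff.mpr (by simpa using h)
    have h2 : 0 ≤ Complex.arg (1 - ζ⁻¹) :=
      Complex.arg_nonneg_iff.mpr (by rw [him]; exact (div_pos h hn).le)
    constructor <;> linarith

lemma Complex.norm_exp_mul_log_one_sub {ζ : ℂ} (hζ : -ζ ∈ Complex.slitPlane) (b : ℝ) :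
    ‖Complex.exp (b * (Complex.log (1 - ζ) - Complex.log (1 - ζ⁻¹)))‖ = ‖ζ‖ ^ b := by
  have hζ0 : ζ ≠ 0 := fun h => by simp [h] at hζ
  have h1 : 1 - ζ⁻¹ ≠ 0 := Complex.slitPlane_ne_zero
    (Complex.one_sub_mem_slitPlane_of_neg_mem (Complex.neg_inv_mem_slitPlane hζ))
  have hmul : 1 - ζ = -ζ * (1 - ζ⁻¹) := by
    rw [mul_sub, neg_mul ζ ζ⁻¹, mul_inv_cancel₀ hζ0]; ring
  rw [Complex.norm_exp, Complex.re_ofReal_mul, Complex.sub_re, Complex.log_re, Complex.log_re,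
    hmul, norm_mul, norm_neg, Real.log_mul (norm_ne_zero_iff.mpr hζ0) (norm_ne_zero_iff.mpr h1),
    add_sub_cancel_right, Real.rpow_def_of_pos (norm_pos_iff.mpr hζ0), mul_comm]

lemma AnalyticAt.eq_of_eventuallyEq_of_radial {f g : ℂ → ℂ} {z : ℂ} {s t : ℝ}
    (hf : ∀ x ∈ uIcc s t, AnalyticAt ℂ f (x * z)) (hg : ∀ x ∈ uIcc s t, AnalyticAt ℂ g (x * z))
    (h : f =ᶠ[nhds (s * z)] g) : f (t * z) = g (t * z) := by
  set U : Set ℂ := (fun x : ℝ => (x : ℂ) * z) '' uIcc s t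
  have hU : IsPreconnected U :=
    isPreconnected_uIcc.image _ (by fun_prop)
  have hfU : AnalyticOnNhd ℂ f U := by rintro _ ⟨x, hx, rfl⟩; exact hf x hx
  have hgU : AnalyticOnNhd ℂ g U := by rintro _ ⟨x, hx, rfl⟩; exact hg x hx
  exact hfU.eqOn_of_preconnected_of_eventuallyEq hgU hU ⟨s, left_mem_uIcc, rfl⟩ h
    ⟨t, right_mem_uIcc, rfl⟩

/-- The complement of the closed rays from the origin through the points `a k`. -/
def rayComplement {m : ℕ} (a : Fin m → ℂ) : Set ℂ :=
  {z | ∀ k, -(z / a k) ∈ Complex.slitPlane}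

lemma isOpen_rayComplement {m : ℕ} (a : Fin m → ℂ) : IsOpen (rayComplement a) := by
  simp only [rayComplement, ofPred_forall]
  exact isOpen_iInter_of_finite fun k => Complex.isOpen_slitPlane.preimage (by fun_prop)

/-- The complement of the closed rays from the points `a k` to infinity. -/
def outerRayComplement {m : ℕ} (a : Fin m → ℂ) : Set ℂ :=
  {z | ∀ k, 1 - z / a k ∈ Complex.slitPlane}

lemma isOpen_outerRayComplement {m : ℕ} (a : Fin m → ℂ) : IsOpen (outerRayComplement a) := by
  simp only [outerRayComplement, ofPred_forall]
  exact isOpen_iInter_of_finite fun k => Complex.isOpen_slitPlane.preimage (by fun_prop)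

lemma rayComplement_subset_outerRayComplement {m : ℕ} (a : Fin m → ℂ) :
    rayComplement a ⊆ outerRayComplement a :=
  fun _ hz k => Complex.one_sub_mem_slitPlane_of_neg_mem (hz k)

lemma ofReal_mul_notMem_rayComplement {m : ℕ} {a : Fin m → ℂ} (ha : ∀ k, ‖a k‖ = 1) {t : ℝ}
    (ht : 0 ≤ t) (k : Fin m) : (t : ℂ) * a k ∉ rayComplement a := fun h => by
  have hk : a k ≠ 0 := fun h0 => by simpa [h0] using ha k
  have := h k
  rw [mul_div_cancel_right₀ _ hk, ← Complex.ofReal_neg, Complex.ofReal_mem_slitPlane] at this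
  linarith

lemma ofReal_mul_notMem_outerRayComplement {m : ℕ} {a : Fin m → ℂ} (ha : ∀ k, ‖a k‖ = 1) {t : ℝ}
    (ht : 1 ≤ t) (k : Fin m) : (t : ℂ) * a k ∉ outerRayComplement a := fun h => by
  have hk : a k ≠ 0 := fun h0 => by simpa [h0] using ha k
  have := h k
  rw [mul_div_cancel_right₀ _ hk, ← Complex.ofReal_one, ← Complex.ofReal_sub,
    Complex.ofReal_mem_slitPlane] at this
  linarith

lemma mem_rayComplement_of_forall_ne {m : ℕ} {a : Fin m → ℂ} (ha : ∀ k, ‖a k‖ = 1) {z : ℂ}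
    (hz : ∀ k, (‖z‖ : ℂ) * a k ≠ z) : z ∈ rayComplement a := fun k => by
  by_contra h
  have hk : a k ≠ 0 := fun h0 => by simpa [h0] using ha k
  have := Complex.eq_norm_of_neg_notMem_slitPlane h
  rw [norm_div, ha, div_one, div_eq_iff hk] at this
  exact hz k this.symm

lemma mem_rayComplement_of_notMem_iUnion {m : ℕ} {a : Fin m → ℂ} (ha : ∀ k, ‖a k‖ = 1) {s : Set ℝ}
    {z : ℂ} (hzs : ‖z‖ ∈ s) (hz : z ∉ ⋃ k, (fun t : ℝ => (t : ℂ) * a k) '' s) :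
    z ∈ rayComplement a :=
  mem_rayComplement_of_forall_ne ha fun k hk => hz (mem_iUnion.mpr ⟨k, ‖z‖, hzs, hk⟩)

lemma smul_mem_rayComplement {m : ℕ} {a : Fin m → ℂ} {z : ℂ} (hz : z ∈ rayComplement a) {t : ℝ}
    (ht : 0 < t) : (t : ℂ) * z ∈ rayComplement a := fun k => by
  have := Complex.ofReal_mul_mem_slitPlane (hz k) ht
  rwa [mul_neg, ← mul_div_assoc] at this

lemma smul_mem_outerRayComplement {m : ℕ} {a : Fin m → ℂ} {z : ℂ} (hz : z ∈ rayComplement a)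
    {t : ℝ} (ht : 0 ≤ t) : (t : ℂ) * z ∈ outerRayComplement a := fun k => by
  have := Complex.one_sub_ofReal_mul_mem_slitPlane (hz k) ht
  rwa [← mul_div_assoc] at this

lemma conj_inv_div_eq {a : ℂ} (ha : ‖a‖ = 1) (z : ℂ) :
    (starRingEnd ℂ z)⁻¹ / a = starRingEnd ℂ (z / a)⁻¹ := by
  have : starRingEnd ℂ a = a⁻¹ := by
    rw [Complex.inv_def, Complex.normSq_eq_norm_sq, ha]; simp
  rw [map_inv₀, map_div₀, this]
  simp [div_eq_mul_inv, mul_comm]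

lemma conj_inv_mem_rayComplement {m : ℕ} {a : Fin m → ℂ} (ha : ∀ k, ‖a k‖ = 1) {z : ℂ}
    (hz : z ∈ rayComplement a) : (starRingEnd ℂ z)⁻¹ ∈ rayComplement a := fun k => by
  rw [conj_inv_div_eq (ha k)]
  exact Complex.neg_conj_mem_slitPlane (Complex.neg_inv_mem_slitPlane (hz k))

lemma differentiableAt_mul_prod_exp_log {m : ℕ} {a : Fin m → ℂ} (β : Fin m → ℝ) {G : ℂ → ℂ} {z : ℂ}
    (hG : DifferentiableAt ℂ G z) (hz : z ∈ outerRayComplement a) :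
    DifferentiableAt ℂ (fun z => G z * ∏ k, Complex.exp (β k * Complex.log (1 - z / a k))) z := by
  refine hG.mul (DifferentiableAt.fun_finsetProd fun k _ => ?_)
  have : DifferentiableAt ℂ (fun z => 1 - z / a k) z := by fun_prop
  exact ((this.clog (hz k)).const_mul _).cexp

lemma DifferentiableAt.inv_conj_conj_inv {F : ℂ → ℂ} {z : ℂ} (hz : z ≠ 0)
    (hF : DifferentiableAt ℂ F (starRingEnd ℂ z)⁻¹) (hF0 : F (starRingEnd ℂ z)⁻¹ ≠ 0) :
    DifferentiableAt ℂ (fun z => (starRingEnd ℂ (F (starRingEnd ℂ z)⁻¹))⁻¹) z := by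
  have h1 : DifferentiableAt ℂ (starRingEnd ℂ ∘ F ∘ starRingEnd ℂ) z⁻¹ := by
    have : DifferentiableAt ℂ F (starRingEnd ℂ z⁻¹) := by rwa [map_inv₀]
    simpa using this.conj_conj
  have h2 : DifferentiableAt ℂ (fun z => starRingEnd ℂ (F (starRingEnd ℂ z)⁻¹)) z := by
    refine (h1.comp z (differentiableAt_inv hz)).congr_of_eventuallyEq (.of_forall fun y => ?_)
    simp
  exact h2.inv (by simpa using hF0)

lemma inv_conj_mul_prod_exp_log {m : ℕ} {a : Fin m → ℂ} (ha : ∀ k, ‖a k‖ = 1) (β : Fin m → ℝ)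
    (G : ℂ → ℂ) {z : ℂ} (hz : z ∈ rayComplement a) :
    (starRingEnd ℂ (G (starRingEnd ℂ z)⁻¹ *
      ∏ k, Complex.exp (β k * Complex.log (1 - (starRingEnd ℂ z)⁻¹ / a k))))⁻¹
      = (starRingEnd ℂ (G (starRingEnd ℂ z)⁻¹))⁻¹ *
        ∏ k, Complex.exp (-(β k * Complex.log (1 - (z / a k)⁻¹))) := by
  rw [map_mul, mul_inv, map_prod, ← Finset.prod_inv_distrib]
  congr 1
  refine Finset.prod_congr rfl fun k _ => ?_
  have hs : 1 - (z / a k)⁻¹ ∈ Complex.slitPlane :=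
    Complex.one_sub_mem_slitPlane_of_neg_mem (Complex.neg_inv_mem_slitPlane (hz k))
  rw [conj_inv_div_eq (ha k), ← Complex.exp_conj, Complex.exp_neg, map_mul, Complex.conj_ofReal,
    ← Complex.log_conj _ ?_]
  · simp
  · have : 1 - starRingEnd ℂ (z / a k)⁻¹ = starRingEnd ℂ (1 - (z / a k)⁻¹) := by simp
    rw [this]
    refine Complex.slitPlane_arg_ne_pi ?_
    rwa [Complex.mem_slitPlane_iff, Complex.conj_re, Complex.conj_im, neg_ne_zero,
      ← Complex.mem_slitPlane_iff]

/-- The integral defining the Szegő function, as a Schwarz integral. -/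
lemma inv_four_pi_mul_integral_eq_schwarzIntegral (h : ℂ → ℝ) (z : ℂ) :
    ((4 * π : ℝ)⁻¹ : ℂ) * ∫ θ in (0:ℝ)..(2 * π), (h (Complex.exp (θ * Complex.I)) : ℂ) *
        ((Complex.exp (θ * Complex.I) + z) / (Complex.exp (θ * Complex.I) - z))
      = schwarzIntegral (fun ζ => (h ζ : ℂ)) 1 z / 2 := by
  have : ∀ θ : ℝ, circleMap 0 1 θ = Complex.exp (θ * Complex.I) := fun θ => by simp [circleMap]
  rw [schwarzIntegral, Real.circleAverage_def, Complex.real_smul]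
  simp only [this]
  simp_rw [mul_comm _ ((h _ : ℝ) : ℂ)]
  push_cast
  rw [mul_inv, mul_inv]
  ring

/-- The scattering function is the product of a continuous zero-free function and explicit powers
carrying the jumps. -/
lemma exists_scattering_factorization {ρ : ℝ} (hρ0 : 0 < ρ) (hρ1 : ρ < 1) {m : ℕ}
    {a : Fin m → ℂ} (ha : ∀ k, ‖a k‖ = 1) (β : Fin m → ℝ) {w : ℂ → ℂ}
    (hw : DifferentiableOn ℂ w {z : ℂ | ρ < ‖z‖ ∧ ‖z‖ < 1/ρ})
    (hw_ne : ∀ z : ℂ, ρ < ‖z‖ → ‖z‖ < 1/ρ → w z ≠ 0)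
    (hw_pos : ∀ z : ℂ, ‖z‖ = 1 → 0 < (w z).re ∧ (w z).im = 0) {W : ℂ → ℝ}
    (hW : ∀ z : ℂ, ‖z‖ = 1 → W z = (w z).re * ∏ k, ‖z - a k‖ ^ (2 * β k)) {Di De : ℂ → ℂ}
    (hDi : ∀ z : ℂ, ‖z‖ < 1 →
      Di z = Complex.exp (schwarzIntegral (fun ζ => (Real.log (W ζ) : ℂ)) 1 z / 2))
    (hDe : ∀ z : ℂ, 1 < ‖z‖ →
      De z = Complex.exp (schwarzIntegral (fun ζ => (Real.log (W ζ) : ℂ)) 1 z / 2))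
    (hDi_an : AnalyticOn ℂ Di
      ({z : ℂ | ‖z‖ < 1/ρ} \ ⋃ k, (fun t : ℝ => (t : ℂ) * a k) '' Set.Ico 1 (1/ρ)))
    (hDe_an : AnalyticOn ℂ De
      ({z : ℂ | ρ < ‖z‖} \ ⋃ k, (fun t : ℝ => (t : ℂ) * a k) '' Set.Ioc ρ 1)) :
    ∃ Q : ℂ → ℂ, ContinuousOn Q {z : ℂ | ρ < ‖z‖ ∧ ‖z‖ < 1/ρ} ∧
      (∀ z : ℂ, ρ < ‖z‖ → ‖z‖ < 1/ρ → Q z ≠ 0) ∧ (∀ z : ℂ, ‖z‖ = 1 → ‖Q z‖ = 1) ∧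
      ∀ z : ℂ, ρ < ‖z‖ → ‖z‖ < 1/ρ → z ∈ rayComplement a → Di z * De z = Q z * ∏ k,
        Complex.exp (β k * (Complex.log (1 - z / a k) - Complex.log (1 - (z / a k)⁻¹))) := by
  have hρ' : 1 < 1/ρ := (one_lt_div hρ0).mpr hρ1
  obtain ⟨G, hGd, hGne, hG⟩ := exists_outer_continuation hρ0 hρ1 hw hw_ne hw_pos
  set F : ℂ → ℂ := fun z => G z * ∏ k, Complex.exp (β k * Complex.log (1 - z / a k)) with hF_def
  set E : ℂ → ℂ := fun z => (starRingEnd ℂ (F (starRingEnd ℂ z)⁻¹))⁻¹ with hE_def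
  have hF0 : ∀ z, ‖z‖ < 1/ρ → F z ≠ 0 := fun z hz =>
    mul_ne_zero (hGne z hz) (Finset.prod_ne_zero_iff.mpr fun k _ => Complex.exp_ne_zero _)
  have hsph : sphere (0 : ℂ) 1 ⊆ {z : ℂ | ρ < ‖z‖ ∧ ‖z‖ < 1/ρ} := fun ζ hζ => by
    have : ‖ζ‖ = 1 := by simpa using hζ
    exact ⟨by linarith, by linarith⟩
  have hFJ : ∀ z, ‖z‖ < 1 →
      F z = Complex.exp (schwarzIntegral (fun ζ => (Real.log (W ζ) : ℂ)) 1 z / 2) := fun z hz => by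
    rw [exp_schwarzIntegral_weight ha β (v := fun z => (w z).re)
      (Complex.continuous_re.comp_continuousOn (hw.continuousOn.mono hsph))
      (fun z hz => (hw_pos z hz).1) hW hz, ← hG z hz]
  have hinv : ∀ z : ℂ, ‖(starRingEnd ℂ z)⁻¹‖ = ‖z‖⁻¹ := fun z => by simp
  have hinvlt : ∀ z : ℂ, ρ < ‖z‖ → ‖(starRingEnd ℂ z)⁻¹‖ < 1/ρ := fun z hz => by
    rw [hinv, one_div]; exact (inv_lt_inv₀ (hρ0.trans hz) hρ0).mpr hz
  have hEJ : ∀ z, 1 < ‖z‖ →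
      E z = Complex.exp (schwarzIntegral (fun ζ => (Real.log (W ζ) : ℂ)) 1 z / 2) := fun z hz => by
    have hz0 : z ≠ 0 := fun h => by simp [h] at hz; linarith
    have h1 : ‖(starRingEnd ℂ z)⁻¹‖ < 1 := by rw [hinv]; exact inv_lt_one_of_one_lt₀ hz
    simp only [hE_def]
    rw [hFJ _ h1, ← Complex.exp_conj, ← Complex.exp_neg,
      schwarzIntegral_reflect (fun ζ => Real.log (W ζ)) hz0, one_div, map_div₀, neg_div,
      Complex.conj_ofNat]
  -- The two branches agree with the explicit functions off the rays.
  have hOi : IsOpen ({z : ℂ | ‖z‖ < 1/ρ} ∩ outerRayComplement a) :=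
    (isOpen_lt continuous_norm continuous_const).inter (isOpen_outerRayComplement a)
  have hOe : IsOpen ({z : ℂ | ρ < ‖z‖} ∩ rayComplement a) :=
    (isOpen_lt continuous_const continuous_norm).inter (isOpen_rayComplement a)
  have hDiN : AnalyticOnNhd ℂ Di ({z : ℂ | ‖z‖ < 1/ρ} ∩ outerRayComplement a) := by
    refine hOi.analyticOn_iff_analyticOnNhd.mp (hDi_an.mono fun z hz => ⟨hz.1, fun h => ?_⟩)
    obtain ⟨k, t, ht, rfl⟩ := mem_iUnion.mp h
    exact ofReal_mul_notMem_outerRayComplement ha ht.1 k hz.2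
  have hDeN : AnalyticOnNhd ℂ De ({z : ℂ | ρ < ‖z‖} ∩ rayComplement a) := by
    refine hOe.analyticOn_iff_analyticOnNhd.mp (hDe_an.mono fun z hz => ⟨hz.1, fun h => ?_⟩)
    obtain ⟨k, t, ht, rfl⟩ := mem_iUnion.mp h
    exact ofReal_mul_notMem_rayComplement ha (hρ0.trans ht.1).le k hz.2
  have hFN : AnalyticOnNhd ℂ F ({z : ℂ | ‖z‖ < 1/ρ} ∩ outerRayComplement a) :=
    DifferentiableOn.analyticOnNhd (fun z hz =>
      (differentiableAt_mul_prod_exp_log β (hGd z hz.1) hz.2).differentiableWithinAt) hOi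
  have hEN : AnalyticOnNhd ℂ E ({z : ℂ | ρ < ‖z‖} ∩ rayComplement a) := by
    refine DifferentiableOn.analyticOnNhd (fun z hz =>
      DifferentiableAt.differentiableWithinAt ?_) hOe
    refine DifferentiableAt.inv_conj_conj_inv (norm_pos_iff.mp (hρ0.trans hz.1)) ?_
      (hF0 _ (hinvlt z hz.1))
    exact differentiableAt_mul_prod_exp_log β (hGd _ (hinvlt z hz.1))
      (rayComplement_subset_outerRayComplement a (conj_inv_mem_rayComplement ha hz.2))
  have hDiF : ∀ z : ℂ, ‖z‖ < 1/ρ → z ∈ rayComplement a → Di z = F z := fun z hz hzc => by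
    have hmem : ∀ x ∈ uIcc (0 : ℝ) 1,
        (x : ℂ) * z ∈ {z : ℂ | ‖z‖ < 1/ρ} ∩ outerRayComplement a := fun x hx => by
      rw [uIcc_of_le zero_le_one] at hx
      refine ⟨?_, smul_mem_outerRayComplement hzc hx.1⟩
      simp only [mem_ofPred_eq, norm_mul, Complex.norm_real, Real.norm_eq_abs, abs_of_nonneg hx.1]
      exact (mul_le_of_le_one_left (norm_nonneg z) hx.2).trans_lt hz
    have := AnalyticAt.eq_of_eventuallyEq_of_radial (fun x hx => hDiN _ (hmem x hx))
      (fun x hx => hFN _ (hmem x hx)) (by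
        filter_upwards [(isOpen_lt continuous_norm continuous_const).mem_nhds
          (show ‖((0 : ℝ) : ℂ) * z‖ < 1 by simp)] with y hy
        rw [hDi y hy, hFJ y hy])
    simpa using this
  have hDeE : ∀ z : ℂ, ρ < ‖z‖ → z ∈ rayComplement a → De z = E z := fun z hz hzc => by
    have hz0 : 0 < ‖z‖ := hρ0.trans hz
    have hmem : ∀ x ∈ uIcc (1 + ‖z‖⁻¹) 1,
        (x : ℂ) * z ∈ {z : ℂ | ρ < ‖z‖} ∩ rayComplement a := fun x hx => by
      rw [uIcc_of_ge (by simp)] at hx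
      have hx0 : 0 < x := by linarith [hx.1]
      refine ⟨?_, smul_mem_rayComplement hzc hx0⟩
      simp only [mem_ofPred_eq, norm_mul, Complex.norm_real, Real.norm_eq_abs, abs_of_pos hx0]
      exact hz.trans_le (le_mul_of_one_le_left hz0.le hx.1)
    have hbig : 1 < ‖((1 + ‖z‖⁻¹ : ℝ) : ℂ) * z‖ := by
      rw [norm_mul, Complex.norm_real, Real.norm_eq_abs, abs_of_pos (by positivity), add_mul,
        inv_mul_cancel₀ hz0.ne']
      linarith
    have := AnalyticAt.eq_of_eventuallyEq_of_radial (fun x hx => hDeN _ (hmem x hx))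
      (fun x hx => hEN _ (hmem x hx)) (by
        filter_upwards [(isOpen_lt continuous_const continuous_norm).mem_nhds hbig] with y hy
        rw [hDe y hy, hEJ y hy])
    simpa using this
  refine ⟨fun z => G z * (starRingEnd ℂ (G (starRingEnd ℂ z)⁻¹))⁻¹, fun z hz => ?_,
    fun z h1 h2 => ?_, fun z hz => ?_, fun z h1 h2 hzc => ?_⟩
  · have hz0 : z ≠ 0 := norm_pos_iff.mp (hρ0.trans hz.1)
    exact ((hGd z hz.2).continuousAt.mul (DifferentiableAt.inv_conj_conj_inv hz0
      (hGd _ (hinvlt z hz.1)) (hGne _ (hinvlt z hz.1))).continuousAt).continuousWithinAt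
  · exact mul_ne_zero (hGne z h2) (inv_ne_zero (by simpa using hGne _ (hinvlt z h1)))
  · have : (starRingEnd ℂ z)⁻¹ = z := by
      rw [Complex.inv_def, Complex.conj_conj, Complex.normSq_eq_norm_sq, Complex.norm_conj, hz]
      simp
    simp only [this, norm_mul, norm_inv, Complex.norm_conj]
    exact mul_inv_cancel₀ (norm_ne_zero_iff.mpr (hGne z (by linarith)))
  · rw [hDiF z h2 hzc, hDeE z h1 hzc]
    simp only [hE_def, hF_def]
    rw [inv_conj_mul_prod_exp_log ha β G hzc]
    rw [mul_mul_mul_comm, ← Finset.prod_mul_distrib]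
    congr 1
    refine Finset.prod_congr rfl fun k _ => ?_
    rw [← Complex.exp_add, mul_sub, ← sub_eq_add_neg]

lemma Complex.im_pos_of_arg_pos_of_re_pos {ζ : ℂ} (h : 0 < Complex.arg ζ) (hre : 0 < ζ.re) :
    0 < ζ.im := by
  refine (Complex.arg_nonneg_iff.mp h.le).lt_of_ne' fun him => h.ne' ?_
  exact Complex.arg_eq_zero_iff.mpr ⟨hre.le, him⟩

lemma eventually_div_re_pos {a : ℂ} (ha : a ≠ 0) {x : ℝ} (hx : 0 < x) :
    ∀ᶠ z in nhds ((x : ℂ) * a), 0 < (z / a).re := by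
  have hc : Continuous fun z : ℂ => (z / a).re := by fun_prop
  refine (isOpen_lt continuous_const hc).mem_nhds ?_
  simpa [ha] using hx

lemma tendsto_exp_mul_log_one_sub_of_arg_pos {a : ℂ} (ha : a ≠ 0) {x : ℝ} (hx : 0 < x) (b : ℝ) :
    Tendsto (fun z => Complex.exp (b * (Complex.log (1 - z / a) - Complex.log (1 - (z / a)⁻¹))))
      (nhdsWithin ((x : ℂ) * a) {z : ℂ | 0 < Complex.arg (z / a)})
      (nhds (Complex.exp (b * (Real.log x - π * Complex.I)))) := by
  have him : ∀ᶠ z in nhdsWithin ((x : ℂ) * a) {z : ℂ | 0 < Complex.arg (z / a)},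
      0 < (z / a).im := by
    filter_upwards [self_mem_nhdsWithin,
      (eventually_div_re_pos ha hx).filter_mono nhdsWithin_le_nhds] with z h1 h2
    exact Complex.im_pos_of_arg_pos_of_re_pos h1 h2
  have ht : Tendsto (fun z => -(z / a)) (nhdsWithin ((x : ℂ) * a) {z : ℂ | 0 < Complex.arg (z / a)})
      (nhdsWithin (-x) {z : ℂ | z.im < 0}) := by
    refine tendsto_nhdsWithin_iff.mpr ⟨?_, him.mono fun z hz => by simpa using hz⟩
    have hc : Continuous fun z : ℂ => -(z / a) := by fun_prop
    have := (hc.tendsto ((x : ℂ) * a)).mono_left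
      (nhdsWithin_le_nhds (s := {z : ℂ | 0 < Complex.arg (z / a)}))
    rwa [mul_div_cancel_right₀ _ ha] at this
  have hlog := (Complex.tendsto_log_nhdsWithin_im_neg_of_re_neg_of_im_zero (z := -x)
    (by simpa using hx) (by simp)).comp ht
  rw [norm_neg, Complex.norm_real, Real.norm_eq_abs, abs_of_pos hx] at hlog
  refine ((hlog.const_mul (b : ℂ)).cexp).congr' ?_
  filter_upwards [him] with z hz
  rw [Complex.log_one_sub_sub_log_one_sub_inv hz.ne', Function.comp_apply]

lemma tendsto_exp_mul_log_one_sub_of_arg_neg {a : ℂ} (ha : a ≠ 0) {x : ℝ} (hx : 0 < x) (b : ℝ) :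
    Tendsto (fun z => Complex.exp (b * (Complex.log (1 - z / a) - Complex.log (1 - (z / a)⁻¹))))
      (nhdsWithin ((x : ℂ) * a) {z : ℂ | Complex.arg (z / a) < 0})
      (nhds (Complex.exp (b * (Real.log x + π * Complex.I)))) := by
  have him : ∀ᶠ z in nhdsWithin ((x : ℂ) * a) {z : ℂ | Complex.arg (z / a) < 0},
      (z / a).im < 0 := by
    filter_upwards [self_mem_nhdsWithin] with z hz
    exact Complex.arg_neg_iff.mp hz
  have ht : Tendsto (fun z => -(z / a)) (nhdsWithin ((x : ℂ) * a) {z : ℂ | Complex.arg (z / a) < 0})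
      (nhdsWithin (-x) {z : ℂ | 0 ≤ z.im}) := by
    refine tendsto_nhdsWithin_iff.mpr ⟨?_, him.mono fun z hz => by simpa using hz.le⟩
    have hc : Continuous fun z : ℂ => -(z / a) := by fun_prop
    have := (hc.tendsto ((x : ℂ) * a)).mono_left
      (nhdsWithin_le_nhds (s := {z : ℂ | Complex.arg (z / a) < 0}))
    rwa [mul_div_cancel_right₀ _ ha] at this
  have hlog := (Complex.tendsto_log_nhdsWithin_im_nonneg_of_re_neg_of_im_zero (z := -x)
    (by simpa using hx) (by simp)).comp ht
  rw [norm_neg, Complex.norm_real, Real.norm_eq_abs, abs_of_pos hx] at hlog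
  refine ((hlog.const_mul (b : ℂ)).cexp).congr' ?_
  filter_upwards [him] with z hz
  rw [Complex.log_one_sub_sub_log_one_sub_inv hz.ne, Function.comp_apply]

lemma neg_div_mem_slitPlane_of_ne {a b : ℂ} (ha : ‖a‖ = 1) (hb : ‖b‖ = 1) (hab : a ≠ b) {x : ℝ}
    (hx : 0 < x) : -(x * a / b) ∈ Complex.slitPlane := by
  by_contra h
  have hb0 : b ≠ 0 := fun h0 => by simp [h0] at hb
  have := Complex.eq_norm_of_neg_notMem_slitPlane h
  rw [norm_div, norm_mul, ha, hb, Complex.norm_real, Real.norm_eq_abs, abs_of_pos hx, div_one,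
    mul_one, div_eq_iff hb0] at this
  exact hab (mul_left_cancel₀ (Complex.ofReal_ne_zero.mpr hx.ne') this)

lemma continuousAt_exp_mul_log_one_sub {a z : ℂ} (hz : -(z / a) ∈ Complex.slitPlane) (b : ℝ) :
    ContinuousAt
      (fun z => Complex.exp (b * (Complex.log (1 - z / a) - Complex.log (1 - (z / a)⁻¹)))) z := by
  have h0 : z / a ≠ 0 := fun h => by simp [h] at hz
  have hc : ContinuousAt (fun z : ℂ => z / a) z := by fun_prop
  refine ContinuousAt.cexp (continuousAt_const.mul (ContinuousAt.sub ?_ ?_))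
  · exact (continuousAt_const.sub hc).clog (Complex.one_sub_mem_slitPlane_of_neg_mem hz)
  · exact (continuousAt_const.sub (hc.inv₀ h0)).clog
      (Complex.one_sub_mem_slitPlane_of_neg_mem (Complex.neg_inv_mem_slitPlane hz))

/-- Near an interior point of the ray through `a k`, only the `k`-th power of the scattering
function jumps. -/
lemma tendsto_scattering_of_tendsto {ρ : ℝ} (hρ0 : 0 < ρ) {m : ℕ} {a : Fin m → ℂ}
    (ha : ∀ k, ‖a k‖ = 1) (ha' : Function.Injective a) (β : Fin m → ℝ) {Q S : ℂ → ℂ}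
    (hQ : ContinuousOn Q {z : ℂ | ρ < ‖z‖ ∧ ‖z‖ < 1/ρ})
    (hS : ∀ z : ℂ, ρ < ‖z‖ → ‖z‖ < 1/ρ → z ∈ rayComplement a → S z = Q z * ∏ k,
      Complex.exp (β k * (Complex.log (1 - z / a k) - Complex.log (1 - (z / a k)⁻¹))))
    (k : Fin m) {x : ℝ} (hx1 : ρ < x) (hx2 : x < 1/ρ) {s : Set ℂ}
    (hs : ∀ z ∈ s, Complex.arg (z / a k) ≠ 0) {L : ℂ}
    (hL : Tendsto (fun z => Complex.exp
      (β k * (Complex.log (1 - z / a k) - Complex.log (1 - (z / a k)⁻¹))))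
      (nhdsWithin ((x : ℂ) * a k) s) (nhds L)) :
    Tendsto S (nhdsWithin ((x : ℂ) * a k) s)
      (nhds (Q (x * a k) * (L * ∏ j ∈ Finset.univ.erase k, Complex.exp (β j *
        (Complex.log (1 - x * a k / a j) - Complex.log (1 - (x * a k / a j)⁻¹)))))) := by
  have hx : 0 < x := hρ0.trans hx1
  have hk0 : a k ≠ 0 := fun h0 => by simpa [h0] using ha k
  have hAo : IsOpen {z : ℂ | ρ < ‖z‖ ∧ ‖z‖ < 1/ρ} :=
    (isOpen_lt continuous_const continuous_norm).inter (isOpen_lt continuous_norm continuous_const)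
  have hxA : (x : ℂ) * a k ∈ {z : ℂ | ρ < ‖z‖ ∧ ‖z‖ < 1/ρ} := by
    simpa [ha, abs_of_pos hx] using And.intro hx1 hx2
  have hAn := hAo.mem_nhds hxA
  have hslit : ∀ j, j ≠ k → -(x * a k / a j) ∈ Complex.slitPlane := fun j hj =>
    neg_div_mem_slitPlane_of_ne (ha k) (ha j) (ha'.ne hj.symm) hx
  have hprod : Tendsto (fun z => ∏ j ∈ Finset.univ.erase k, Complex.exp (β j *
      (Complex.log (1 - z / a j) - Complex.log (1 - (z / a j)⁻¹))))
      (nhdsWithin ((x : ℂ) * a k) s) (nhds (∏ j ∈ Finset.univ.erase k, Complex.exp (β j *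
        (Complex.log (1 - x * a k / a j) - Complex.log (1 - (x * a k / a j)⁻¹))))) :=
    tendsto_finsetProd _ fun j hj => (continuousAt_exp_mul_log_one_sub
      (hslit j (Finset.ne_of_mem_erase hj)) (β j)).tendsto.mono_left nhdsWithin_le_nhds
  have hQt : Tendsto Q (nhdsWithin ((x : ℂ) * a k) s) (nhds (Q (x * a k))) :=
    (hQ.continuousAt hAn).tendsto.mono_left nhdsWithin_le_nhds
  refine (hQt.mul (hL.mul hprod)).congr' ?_
  have hother : ∀ᶠ z in nhds ((x : ℂ) * a k), ∀ j, j ≠ k → -(z / a j) ∈ Complex.slitPlane := by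
    refine eventually_all.mpr fun j => ?_
    by_cases hj : j = k
    · exact .of_forall fun z h => absurd hj h
    · have hc : ContinuousAt (fun z : ℂ => -(z / a j)) (x * a k) := by fun_prop
      exact (hc.eventually_mem (Complex.isOpen_slitPlane.mem_nhds (hslit j hj))).mono
        fun z hz _ => hz
  filter_upwards [self_mem_nhdsWithin, mem_nhdsWithin_of_mem_nhds hAn,
    (eventually_div_re_pos hk0 hx).filter_mono nhdsWithin_le_nhds,
    hother.filter_mono nhdsWithin_le_nhds] with z hzs hzA hre hzo
  have hzc : z ∈ rayComplement a := fun j => by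
    by_cases hj : j = k
    · subst hj
      rw [Complex.mem_slitPlane_iff]
      right
      rw [Complex.neg_im, neg_ne_zero]
      exact fun him => hs z hzs (Complex.arg_eq_zero_iff.mpr ⟨hre.le, him⟩)
    · exact hzo j hj
  rw [hS z hzA.1 hzA.2 hzc, ← Finset.mul_prod_erase Finset.univ _ (Finset.mem_univ k)]

theorem stmt17
    (ρ : ℝ) (hρ0 : 0 < ρ) (hρ1 : ρ < 1)
    (m : ℕ) (hm : 0 < m)
    (a : Fin m → ℂ) (ha : ∀ k, ‖a k‖ = 1) (ha' : Function.Injective a)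
    (β : Fin m → ℝ) (hβ : ∀ k, -(1/2 : ℝ) < β k)
    (w : ℂ → ℂ)
    (hw_an : AnalyticOn ℂ w {z : ℂ | ρ < ‖z‖ ∧ ‖z‖ < 1/ρ})
    (hw_ne : ∀ z : ℂ, ρ < ‖z‖ → ‖z‖ < 1/ρ → w z ≠ 0)
    (hw_pos : ∀ z : ℂ, ‖z‖ = 1 → 0 < (w z).re ∧ (w z).im = 0)
    (W : ℂ → ℝ)
    (hW : ∀ z : ℂ, ‖z‖ = 1 → W z = (w z).re * ∏ k, ‖z - a k‖ ^ (2 * β k))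
    (Di De : ℂ → ℂ)
    (hDi_def : ∀ z : ℂ, ‖z‖ < 1 → Di z =
      Complex.exp (((4 * π : ℝ)⁻¹ : ℂ) * ∫ θ in (0:ℝ)..(2 * π),
        (Real.log (W (Complex.exp (θ * Complex.I))) : ℂ) *
          ((Complex.exp (θ * Complex.I) + z) / (Complex.exp (θ * Complex.I) - z))))
    (hDe_def : ∀ z : ℂ, 1 < ‖z‖ → De z =
      Complex.exp (((4 * π : ℝ)⁻¹ : ℂ) * ∫ θ in (0:ℝ)..(2 * π),
        (Real.log (W (Complex.exp (θ * Complex.I))) : ℂ) *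
          ((Complex.exp (θ * Complex.I) + z) / (Complex.exp (θ * Complex.I) - z))))
    (hDi_an : AnalyticOn ℂ Di
      ({z : ℂ | ‖z‖ < 1/ρ} \ ⋃ k, (fun t : ℝ => (t : ℂ) * a k) '' Set.Ico 1 (1/ρ)))
    (hDe_an : AnalyticOn ℂ De
      ({z : ℂ | ρ < ‖z‖} \ ⋃ k, (fun t : ℝ => (t : ℂ) * a k) '' Set.Ioc ρ 1))
    :
    AnalyticOn ℂ (fun z => Di z * De z)
      ({z : ℂ | ρ < ‖z‖ ∧ ‖z‖ < 1/ρ} \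
        ⋃ k, (fun t : ℝ => (t : ℂ) * a k) '' Set.Ioo ρ (1/ρ)) ∧
    (∀ k : Fin m, ∃ M : ℝ, ∃ rr : ℝ, 0 < rr ∧
      ∀ z ∈ Metric.ball (a k) rr ∩
        ({z : ℂ | ρ < ‖z‖ ∧ ‖z‖ < 1/ρ} \
          ⋃ k', (fun t : ℝ => (t : ℂ) * a k') '' Set.Ioo ρ (1/ρ)),
        ‖Di z * De z‖ ≤ M) ∧
    (∀ k : Fin m, ∀ x : ℝ, ρ < x → x < 1 / ρ → x ≠ 1 →
      ∃ Lp Lm : ℂ,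
        Filter.Tendsto (fun z => Di z * De z)
          (nhdsWithin ((x : ℂ) * a k) {z : ℂ | 0 < Complex.arg (z / a k)}) (nhds Lp) ∧
        Filter.Tendsto (fun z => Di z * De z)
          (nhdsWithin ((x : ℂ) * a k) {z : ℂ | Complex.arg (z / a k) < 0}) (nhds Lm) ∧
        Lp = Complex.exp (((-2 * π * β k : ℝ) : ℂ) * Complex.I) * Lm) ∧
    (∃ g : ℂ → ℝ, ContinuousOn g {z : ℂ | ρ < ‖z‖ ∧ ‖z‖ < 1/ρ} ∧
      (∀ z ∈ {z : ℂ | ρ < ‖z‖ ∧ ‖z‖ < 1/ρ}, 0 < g z) ∧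
      (∀ z ∈ ({z : ℂ | ρ < ‖z‖ ∧ ‖z‖ < 1/ρ} \
        ⋃ k, (fun t : ℝ => (t : ℂ) * a k) '' Set.Ioo ρ (1/ρ)), g z = ‖Di z * De z‖)) ∧
    (∀ z : ℂ, ‖z‖ = 1 → z ∉ Set.range a → ‖Di z * De z‖ = 1) := by
  have hρ' : 1 < 1/ρ := (one_lt_div hρ0).mpr hρ1
  obtain ⟨Q, hQc, hQ0, hQ1, hS⟩ := exists_scattering_factorization hρ0 hρ1 ha β
    hw_an.differentiableOn hw_ne hw_pos hW
    (fun z hz => by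
      rw [hDi_def z hz,
        inv_four_pi_mul_integral_eq_schwarzIntegral (fun ζ => Real.log (W ζ)) z])
    (fun z hz => by
      rw [hDe_def z hz,
        inv_four_pi_mul_integral_eq_schwarzIntegral (fun ζ => Real.log (W ζ)) z])
    hDi_an hDe_an
  set g : ℂ → ℝ := fun z => ‖Q z‖ * ∏ k, ‖z‖ ^ β k with hg_def
  have hgS : ∀ z : ℂ, ρ < ‖z‖ → ‖z‖ < 1/ρ → z ∈ rayComplement a → g z = ‖Di z * De z‖ :=
    fun z h1 h2 hzc => by
      rw [hS z h1 h2 hzc, norm_mul, norm_prod]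
      refine congrArg _ (Finset.prod_congr rfl fun k _ => ?_)
      rw [Complex.norm_exp_mul_log_one_sub (hzc k), norm_div, ha, div_one]
  have hgc : ContinuousOn g {z : ℂ | ρ < ‖z‖ ∧ ‖z‖ < 1/ρ} :=
    hQc.norm.mul (continuousOn_finsetProd _ fun k _ => continuous_norm.continuousOn.rpow_const
      fun z hz => Or.inl (hρ0.trans hz.1).ne')
  have hAo : IsOpen {z : ℂ | ρ < ‖z‖ ∧ ‖z‖ < 1/ρ} :=
    (isOpen_lt continuous_const continuous_norm).inter (isOpen_lt continuous_norm continuous_const)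
  refine ⟨?_, fun k => ?_, fun k x hx1 hx2 _ => ?_, ⟨g, hgc, fun z hz => ?_, fun z hz => ?_⟩,
    fun z hz hza => ?_⟩
  · refine (hDi_an.mono fun z hz => ⟨hz.1.2, fun h => hz.2 ?_⟩).mul
      (hDe_an.mono fun z hz => ⟨hz.1.1, fun h => hz.2 ?_⟩)
    · obtain ⟨k, t, ht, rfl⟩ := mem_iUnion.mp h
      exact mem_iUnion.mpr ⟨k, t, ⟨ht.1, ht.2.trans_lt hρ'⟩, rfl⟩
    · obtain ⟨k, t, ht, rfl⟩ := mem_iUnion.mp h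
      exact mem_iUnion.mpr ⟨k, t, ⟨hρ1.trans_le ht.1, ht.2⟩, rfl⟩
  · have hak : a k ∈ {z : ℂ | ρ < ‖z‖ ∧ ‖z‖ < 1/ρ} := by
      constructor <;> simpa only [ha k]
    obtain ⟨r, hr, hball⟩ := Metric.eventually_nhds_iff_ball.mp
      ((hgc.continuousAt (hAo.mem_nhds hak)).eventually_lt_const (lt_add_one (g (a k))))
    refine ⟨g (a k) + 1, r, hr, fun z hz => ?_⟩
    rw [← hgS z hz.2.1.1 hz.2.1.2 (mem_rayComplement_of_notMem_iUnion ha hz.2.1 hz.2.2)]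
    exact (hball z hz.1).le
  · have hx : 0 < x := hρ0.trans hx1
    have hk0 : a k ≠ 0 := fun h0 => by simpa [h0] using ha k
    refine ⟨_, _, tendsto_scattering_of_tendsto hρ0 ha ha' β hQc hS k hx1 hx2
      (fun z hz => ne_of_gt hz) (tendsto_exp_mul_log_one_sub_of_arg_pos hk0 hx (β k)),
      tendsto_scattering_of_tendsto hρ0 ha ha' β hQc hS k hx1 hx2
      (fun z hz => ne_of_lt hz) (tendsto_exp_mul_log_one_sub_of_arg_neg hk0 hx (β k)), ?_⟩
    rw [mul_left_comm _ (Q _), ← mul_assoc (Complex.exp _) (Complex.exp _), ← Complex.exp_add]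
    congr 4
    push_cast
    ring
  · exact mul_pos (norm_pos_iff.mpr (hQ0 z hz.1 hz.2))
      (Finset.prod_pos fun k _ => Real.rpow_pos_of_pos (hρ0.trans hz.1) _)
  · exact hgS z hz.1.1 hz.1.2 (mem_rayComplement_of_notMem_iUnion ha hz.1 hz.2)
  · rw [← hgS z (by rwa [hz]) (by rwa [hz]) (mem_rayComplement_of_forall_ne ha fun k hk =>
      hza ⟨k, by simpa [hz] using hk⟩)]
    simp [hg_def, hz, hQ1 z hz]
end
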